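/- arXiv:1801.04024 — 2 statements merged into one kernel-verified Lean document; each statement's English description precedes it below -/
import Mathlib

section
/- Let G be a countable ICC group and A a finite set with |A| ≥ 2. Then the set of shifts S ∈ 𝒮 for which the G-action on S is both minimal and proximal contains a dense G_δ subset of 𝒮; in particular it is nonempty. -/
open scoped Pointwise

/-- The left-translation action of `G` on configurations: `(g • s)(h) = s (g⁻¹ * h)`. -/
def shiftAct {G A : Type*} [Group G] (g : G) (s : G → A) : G → A :=
  fun h => s (g⁻¹ * h)

/-- A shift: a nonempty, closed, `G`-invariant subset of the full shift `A^G` (with the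
product topology and the left-translation action). -/
def IsShift {G A : Type*} [Group G] [TopologicalSpace A] (S : Set (G → A)) : Prop :=
  S.Nonempty ∧ IsClosed S ∧ ∀ s ∈ S, ∀ g : G, shiftAct g s ∈ S

/-- A shift `S ⊆ A^G` is strongly irreducible if there is a finite `X ⊆ G` containing the
identity such that for all `E₁, E₂ ⊆ G` with `E₁X ∩ E₂X = ∅` and all `s₁, s₂ ∈ S` there is
`s ∈ S` agreeing with `s₁` on `E₁` and with `s₂` on `E₂`. -/
def StronglyIrreducible {G A : Type*} [Group G] (S : Set (G → A)) : Prop :=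
  ∃ X : Finset G, (1 : G) ∈ X ∧
    ∀ E₁ E₂ : Set G, (E₁ * (X : Set G)) ∩ (E₂ * (X : Set G)) = ∅ →
      ∀ s₁ ∈ S, ∀ s₂ ∈ S, ∃ s ∈ S, (∀ a ∈ E₁, s a = s₁ a) ∧ (∀ a ∈ E₂, s a = s₂ a)

open scoped Classical in
/-- The metric on `A^G` induced by an enumeration `G = {g₁, g₂, …}` (here `e n = g_{n+1}`):
`d(s, t) = 1 / min {n ≥ 1 : s gₙ ≠ t gₙ}` for `s ≠ t`, and `d(s, s) = 0`. -/
noncomputable def confDist {G A : Type*} (e : ℕ → G) (s t : G → A) : ℝ :=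
  if s = t then 0
  else 1 / (((sInf {n : ℕ | s (e n) ≠ t (e n)} : ℕ) : ℝ) + 1)

/-- The space of shifts in `A^G`. -/
abbrev ShiftSpace (G A : Type*) [Group G] [TopologicalSpace A] : Type _ :=
  {S : Set (G → A) // IsShift S}

/-- Two sets of configurations agree on `F ⊆ G` if they have the same sets of restrictions
to `F`. -/
def AgreeOn {G A : Type*} (F : Set G) (S T : Set (G → A)) : Prop :=
  ∀ p : G → A, (∃ s ∈ S, ∀ x ∈ F, s x = p x) ↔ (∃ t ∈ T, ∀ x ∈ F, t x = p x)

open scoped Classical in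
/-- The metric on the space of shifts: `d(S, T) = 1/(n+1)` where `n` is the largest index
such that `S` and `T` agree on `{g₁, …, gₙ}` (with `e k = g_{k+1}`), and `d(S, T) = 0` if
`S = T`. -/
noncomputable def shiftSpaceDist {G A : Type*} [Group G] [TopologicalSpace A] (e : ℕ → G)
    (S T : ShiftSpace G A) : ℝ :=
  if S = T then 0
  else 1 / (((sSup {n : ℕ | AgreeOn {g : G | ∃ k < n, e k = g} S.1 T.1} : ℕ) : ℝ) + 1)

/-- The metric topology on the space of shifts, generated by the open balls of the metric
`shiftSpaceDist`. -/
noncomputable def shiftSpaceTopology (G A : Type*) [Group G] [TopologicalSpace A]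
    (e : ℕ → G) : TopologicalSpace (ShiftSpace G A) :=
  TopologicalSpace.generateFrom
    {U : Set (ShiftSpace G A) |
      ∃ (S : ShiftSpace G A) (ε : ℝ), 0 < ε ∧ U = {T | shiftSpaceDist e S T < ε}}

/-- The space `𝒮`: the closure, in the space of shifts, of the strongly irreducible shifts,
with the `|A|` singleton (constant-configuration) shifts removed. -/
def scriptS (G A : Type*) [Group G] [TopologicalSpace A] (e : ℕ → G) :
    Set (ShiftSpace G A) :=
  @closure _ (shiftSpaceTopology G A e) {S : ShiftSpace G A | StronglyIrreducible S.1} \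
    {S : ShiftSpace G A | ∃ a : A, S.1 = {fun _ => a}}

/-- The subspace topology on `𝒮`. -/
noncomputable def scriptSTopology (G A : Type*) [Group G] [TopologicalSpace A]
    (e : ℕ → G) : TopologicalSpace ↥(scriptS G A e) :=
  TopologicalSpace.induced Subtype.val (shiftSpaceTopology G A e)

/-- A group is ICC if it is nontrivial and every non-identity element has an infinite
conjugacy class. -/
def IsICC (G : Type*) [Group G] : Prop :=
  Nontrivial G ∧ ∀ g : G, g ≠ 1 → {h : G | IsConj g h}.Infinite

/-- The action of `G` on a shift `S` is minimal if every orbit is dense in `S`. -/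
def MinimalShift {G A : Type*} [Group G] [TopologicalSpace A] (S : Set (G → A)) : Prop :=
  ∀ s ∈ S, S ⊆ closure {x : G → A | ∃ g : G, x = shiftAct g s}

/-- The action of `G` on a shift `S` is proximal if for all `s, t ∈ S` the closure of
`{(g • s, g • t) : g ∈ G}` meets the diagonal of `S × S`. -/
def ProximalShift {G A : Type*} [Group G] [TopologicalSpace A] (S : Set (G → A)) : Prop :=
  ∀ s ∈ S, ∀ t ∈ S, ∃ z ∈ S,
    (z, z) ∈ closure {p : (G → A) × (G → A) | ∃ g : G, p = (shiftAct g s, shiftAct g t)}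

section

open Filter Topology

theorem IsICC.infinite {G : Type*} [Group G] (h : IsICC G) : Infinite G := by
  obtain ⟨⟨a, b, hab⟩, h2⟩ := h
  by_cases ha : a = 1
  · exact Set.infinite_univ_iff.1 ((h2 b (fun hb => hab (ha.trans hb.symm))).mono
      (Set.subset_univ _))
  · exact Set.infinite_univ_iff.1 ((h2 a ha).mono (Set.subset_univ _))

theorem IsICC.not_finiteIndex_centralizer {G : Type*} [Group G] (h : IsICC G) {f : G}
    (hf : f ≠ 1) : ¬ (Subgroup.centralizer ({f} : Set G)).FiniteIndex := by
  intro hfin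
  refine h.2 f hf ?_
  have : Finite (G ⧸ Subgroup.centralizer ({f} : Set G)) := inferInstance
  refine (Set.finite_range (fun c : G ⧸ Subgroup.centralizer ({f} : Set G) =>
    Quotient.out c * f * (Quotient.out c)⁻¹)).subset ?_
  rintro x hx
  obtain ⟨c, rfl⟩ := isConj_iff.1 hx
  refine ⟨(c : G ⧸ Subgroup.centralizer ({f} : Set G)), ?_⟩
  obtain ⟨z, hz⟩ := QuotientGroup.mk_out_eq_mul (Subgroup.centralizer ({f} : Set G)) c
  have h1 := Subgroup.mem_centralizer_singleton_iff.1 z.2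
  change Quotient.out (c : G ⧸ Subgroup.centralizer ({f} : Set G)) = _ at hz
  simp only [hz, mul_inv_rev]
  calc c * z * f * ((z : G)⁻¹ * c⁻¹) = c * (z * f) * (z : G)⁻¹ * c⁻¹ := by group
    _ = c * (f * z) * (z : G)⁻¹ * c⁻¹ := by rw [h1]
    _ = c * f * c⁻¹ := by group

theorem IsICC.exists_conj_notMem {G : Type*} [Group G] (h : IsICC G) {N B F : Set G}
    (hN : N.Finite) (hB : B.Finite) (hF : F.Finite) :
    ∃ q, q ∉ N ∧ ∀ a ∈ B, a ≠ 1 → q⁻¹ * a * q ∉ F := by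
  classical
  have := h.infinite
  by_contra! hcon
  let ι := N ⊕ (B × F)
  have : Finite N := hN
  have : Finite B := hB
  have : Finite F := hF
  have : Fintype ι := Fintype.ofFinite _
  let g : ι → G := Sum.elim (fun n => n.1) (fun p =>
    if hp : ∃ q, q⁻¹ * p.1.1 * q = p.2.1 then hp.choose else 1)
  let H : ι → Subgroup G := Sum.elim (fun _ => ⊥) (fun p => if p.2.1 = 1 then ⊥ else
    Subgroup.centralizer {p.2.1})
  have hcov : ⋃ i ∈ (Finset.univ : Finset ι), g i • (H i : Set G) = Set.univ := by
    refine Set.eq_univ_of_forall fun q => ?_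
    simp only [Finset.mem_univ, Set.iUnion_true, Set.mem_iUnion]
    by_cases hq : q ∈ N
    · exact ⟨Sum.inl ⟨q, hq⟩, by simp [g, H]⟩
    · obtain ⟨a, ha, ha1, haF⟩ := hcon q hq
      refine ⟨Sum.inr (⟨a, ha⟩, ⟨_, haF⟩), ?_⟩
      have hp : ∃ r, r⁻¹ * a * r = q⁻¹ * a * q := ⟨q, rfl⟩
      have hne : q⁻¹ * a * q ≠ 1 := by
        intro h0
        apply ha1
        have : q * (q⁻¹ * a * q) * q⁻¹ = 1 := by rw [h0]; group
        rw [← this]; group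
      have hs := hp.choose_spec
      simp only [Sum.elim_inr, dif_pos hp, g, H, if_neg hne, Set.mem_smul_set_iff_inv_smul_mem,
        smul_eq_mul, SetLike.mem_coe, Subgroup.mem_centralizer_singleton_iff]
      generalize hp.choose = r at hs
      calc r⁻¹ * q * (q⁻¹ * a * q) = (r⁻¹ * a * r) * (r⁻¹ * q) := by group
        _ = _ := by rw [hs]
  obtain ⟨i, -, hi⟩ := Subgroup.exists_finiteIndex_of_leftCoset_cover hcov
  have hbot : ¬ (⊥ : Subgroup G).FiniteIndex := by
    intro h0
    have : Finite (G ⧸ (⊥ : Subgroup G)) := inferInstance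
    exact not_finite_iff_infinite.2 ‹Infinite G›
      (Finite.of_equiv _ (QuotientGroup.quotientBot (G := G)).toEquiv)
  rcases i with n | p
  · exact hbot hi
  · by_cases hp : p.2.1 = 1
    · exact hbot (by simpa [H, hp] using hi)
    · exact h.not_finiteIndex_centralizer hp (by simpa [H, hp] using hi)

/-- A set is `Δ`-separated if distinct elements `p`, `q` satisfy `p⁻¹ * q ∉ Δ`. -/
def SeparatedBy {G : Type*} [Group G] (Δ P : Set G) : Prop :=
  ∀ p ∈ P, ∀ q ∈ P, p ≠ q → p⁻¹ * q ∉ Δ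

section IndependentTransversal

open scoped Classical in
theorem card_filter_update_le {κ ω : Type*} [Fintype κ] [Fintype ω]
    (Q : (κ → ω) → Prop) {i j : κ} (hij : i ≠ j)
    (hQ : ∀ f a b, Q f → Q (Function.update (Function.update f i a) j b)) (w w' : ω) :
    Fintype.card ω * Fintype.card ω *
      (Finset.univ.filter fun f : κ → ω => Q f ∧ f i = w ∧ f j = w').card ≤
      (Finset.univ.filter Q).card := by
  rw [← Fintype.card_prod, ← Finset.card_univ, ← Finset.card_product]
  refine Finset.card_le_card_of_injOn
    (fun x => Function.update (Function.update x.2 i x.1.1) j x.1.2) ?_ ?_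
  · rintro ⟨⟨a, b⟩, f⟩ hx
    simp only [Finset.coe_product, Set.mem_prod, Finset.mem_coe, Finset.mem_filter,
      Finset.mem_univ, true_and] at hx ⊢
    exact hQ _ _ _ hx.1
  · rintro ⟨⟨a, b⟩, f⟩ hx ⟨⟨a', b'⟩, f'⟩ hx' heq
    simp only [Finset.coe_product, Set.mem_prod, Finset.mem_coe, Finset.mem_filter,
      Finset.mem_univ, true_and] at hx hx' heq
    have hi := congrFun heq i
    have hj := congrFun heq j
    simp only [Function.update_self, Function.update_of_ne hij] at hi hj
    refine Prod.ext (Prod.ext hi hj) (funext fun k => ?_)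
    by_cases hki : k = i
    · subst hki; exact hx.2.1.trans hx'.2.1.symm
    by_cases hkj : k = j
    · subst hkj; exact hx.2.2.trans hx'.2.2.symm
    have hk := congrFun heq k
    simpa only [Function.update_of_ne hki, Function.update_of_ne hkj] using hk

open scoped Classical in
/-- Existence of independent transversals, by Rosenfeld's counting argument. -/
theorem exists_independent_transversal {κ ω : Type*} [Fintype κ] [Fintype ω] [Nonempty ω]
    (R : κ × ω → κ × ω → Prop) (hsymm : ∀ x y, R x y → R y x) (d : ℕ)
    (hd : ∀ x, (Finset.univ.filter (R x)).card ≤ d) (hω : 4 * d ≤ Fintype.card ω) :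
    ∃ f : κ → ω, ∀ i j, i ≠ j → ¬ R (i, f i) (j, f j) := by
  let I : Finset κ → (κ → ω) → Prop := fun S f =>
    ∀ i ∈ S, ∀ j ∈ S, i ≠ j → ¬ R (i, f i) (j, f j)
  let N : Finset κ → ℕ := fun S => (Finset.univ.filter (I S)).card
  have hI : ∀ S T, S ⊆ T → ∀ f, I T f → I S f := fun S T h f hf i hi j hj =>
    hf i (h hi) j (h hj)
  have key : ∀ n, ∀ S : Finset κ, S.card = n → ∀ i ∉ S, N S ≤ 2 * N (insert i S) := by
    intro n
    induction n using Nat.strong_induction_on with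
    | _ n ih =>
      intro S hS i hi
      let Bad : ω × (κ × ω) → Finset (κ → ω) := fun x =>
        Finset.univ.filter fun f => I (S.erase x.2.1) f ∧ f i = x.1 ∧ f x.2.1 = x.2.2
      let J : Finset (ω × (κ × ω)) :=
        Finset.univ.filter fun x => R (i, x.1) x.2 ∧ x.2.1 ∈ S
      have hsub : Finset.univ.filter (I S) ⊆
          Finset.univ.filter (I (insert i S)) ∪ J.biUnion Bad := by
        intro f hf
        simp only [Finset.mem_filter, Finset.mem_univ, true_and, Finset.mem_union,
          Finset.mem_biUnion] at hf ⊢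
        by_contra! hcon
        obtain ⟨h1, h2⟩ := hcon
        have hno : ∀ j ∈ S, ¬ R (i, f i) (j, f j) := fun j hj hR => by
          refine h2 (f i, (j, f j)) (by simp [J, hR, hj]) ?_
          simp only [Bad, Finset.mem_filter, Finset.mem_univ, true_and, and_true]
          exact hI _ _ (Finset.erase_subset _ _) _ hf
        apply h1
        intro a ha b hb hab
        rcases Finset.mem_insert.1 ha with rfl | ha'
        · rcases Finset.mem_insert.1 hb with rfl | hb'
          · exact absurd rfl hab
          · exact hno b hb'
        · rcases Finset.mem_insert.1 hb with rfl | hb'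
          · exact fun hR => hno a ha' (hsymm _ _ hR)
          · exact hf a ha' b hb' hab
      have hJ : J.card ≤ Fintype.card ω * d := by
        have : J ⊆ Finset.univ.biUnion fun w : ω =>
            (Finset.univ.filter (R (i, w))).image (Prod.mk w) := by
          rintro ⟨w, y⟩ hx
          simp only [J, Finset.mem_filter, Finset.mem_univ, true_and] at hx
          simp [hx.1]
        refine (Finset.card_le_card this).trans ?_
        refine (Finset.card_biUnion_le_card_mul _ _ d fun w _ => ?_)
        exact Finset.card_image_le.trans (hd _)
      have hBad : ∀ x ∈ J, Fintype.card ω * Fintype.card ω * (Bad x).card ≤ 2 * N S := by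
        rintro ⟨w, j, w'⟩ hx
        simp only [J, Finset.mem_filter, Finset.mem_univ, true_and] at hx
        have hij : i ≠ j := by rintro rfl; exact hi hx.2
        have hle := card_filter_update_le (I (S.erase j)) hij ?_ w w'
        · have h2 := ih (S.erase j).card (by rw [← hS]; exact Finset.card_erase_lt_of_mem hx.2)
            (S.erase j) rfl j (Finset.notMem_erase j S)
          rw [Finset.insert_erase hx.2] at h2
          refine (Eq.le ?_).trans (hle.trans ((Eq.le ?_).trans h2)) <;> congr!
        · intro f a b hf k hk l hl hkl
          have hk' := Finset.mem_erase.1 hk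
          have hl' := Finset.mem_erase.1 hl
          have hki : k ≠ i := by rintro rfl; exact hi hk'.2
          have hli : l ≠ i := by rintro rfl; exact hi hl'.2
          simp only [Function.update_of_ne hki, Function.update_of_ne hli,
            Function.update_of_ne hk'.1, Function.update_of_ne hl'.1]
          exact hf k hk l hl hkl
      have hpos : 0 < Fintype.card ω := Fintype.card_pos
      set m := Fintype.card ω
      have hsum : m * m * (J.biUnion Bad).card ≤ m * d * (2 * N S) := by
        calc m * m * (J.biUnion Bad).card ≤ m * m * ∑ x ∈ J, (Bad x).card := by
              gcongr; exact Finset.card_biUnion_le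
          _ = ∑ x ∈ J, m * m * (Bad x).card := by rw [Finset.mul_sum]
          _ ≤ ∑ x ∈ J, 2 * N S := Finset.sum_le_sum hBad
          _ = J.card * (2 * N S) := by simp
          _ ≤ m * d * (2 * N S) := by gcongr
      have hNS : N S ≤ N (insert i S) + (J.biUnion Bad).card :=
        (Finset.card_le_card hsub).trans (Finset.card_union_le _ _)
      have h2 : 2 * (J.biUnion Bad).card ≤ N S := by
        have : m * m * (2 * (J.biUnion Bad).card) ≤ m * m * N S := by
          calc m * m * (2 * (J.biUnion Bad).card) = 2 * (m * m * (J.biUnion Bad).card) := by ring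
            _ ≤ 2 * (m * d * (2 * N S)) := by gcongr
            _ = m * (4 * d) * N S := by ring
            _ ≤ m * m * N S := by gcongr
        exact Nat.le_of_mul_le_mul_left this (by positivity)
      omega
  have hpos : ∀ S, 0 < N S := by
    intro S
    induction S using Finset.induction_on with
    | empty =>
      refine Finset.card_pos.2 ⟨fun _ => Classical.arbitrary ω, ?_⟩
      simp [I]
    | insert i S hi ih => have := key _ S rfl i hi; omega
  obtain ⟨f, hf⟩ := Finset.card_pos.1 (hpos Finset.univ)
  simp only [Finset.mem_filter, Finset.mem_univ, true_and] at hf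
  exact ⟨f, fun i j hij => hf i (Finset.mem_univ _) j (Finset.mem_univ _) hij⟩

end IndependentTransversal

theorem SeparatedBy.exists_maximal {G : Type*} [Group G] {H N I₀ : Set G}
    (hH1 : 1 ∈ H) (hH : ∀ x ∈ H, x⁻¹ ∈ H) (hI₀ : SeparatedBy H I₀) (hN : ∀ c ∈ I₀, c ∉ N) :
    ∃ I, I₀ ⊆ I ∧ SeparatedBy H I ∧ (∀ c ∈ I, c ∉ N) ∧ ∀ g, g ∉ N → ∃ c ∈ I, g⁻¹ * c ∈ H := by
  obtain ⟨I, hsub, hmax⟩ := zorn_subset_nonempty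
    {I : Set G | SeparatedBy H I ∧ ∀ c ∈ I, c ∉ N} (by
      intro c hc hchain hne
      refine ⟨⋃₀ c, ⟨?_, ?_⟩, fun s hs => Set.subset_sUnion_of_mem hs⟩
      · rintro p ⟨s, hs, hp⟩ q ⟨t, ht, hq⟩ hpq
        rcases hchain.total hs ht with h | h
        · exact (hc ht).1 p (h hp) q hq hpq
        · exact (hc hs).1 p hp q (h hq) hpq
      · rintro p ⟨s, hs, hp⟩
        exact (hc hs).2 p hp) I₀ ⟨hI₀, hN⟩
  refine ⟨I, hsub, hmax.prop.1, hmax.prop.2, fun g hg => ?_⟩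
  by_contra! hcon
  have hins : insert g I ∈ {I : Set G | SeparatedBy H I ∧ ∀ c ∈ I, c ∉ N} := by
    refine ⟨?_, ?_⟩
    · rintro p (rfl | hp) q (rfl | hq) hpq
      · exact absurd rfl hpq
      · exact hcon q hq
      · intro h
        exact hcon p hp (by simpa using hH _ h)
      · exact hmax.prop.1 p hp q hq hpq
    · rintro p (rfl | hp)
      · exact hg
      · exact hmax.prop.2 p hp
  have hgI : g ∈ I := hmax.le_of_ge hins (Set.subset_insert g I) (Set.mem_insert g I)
  exact hcon g hgI (by simpa using hH1)

theorem IsICC.exists_separated_hitting {G : Type*} [Group G] (h : IsICC G) {Δ : Set G}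
    (hΔ : Δ.Finite) (h1 : 1 ∈ Δ) (hinv : ∀ x ∈ Δ, x⁻¹ ∈ Δ) :
    ∃ P Q : Set G, P.Finite ∧ Q.Finite ∧ P.Nonempty ∧ Q.Nonempty ∧
      SeparatedBy Δ P ∧ SeparatedBy Δ Q ∧ ∀ v ∈ P * Δ * P⁻¹, ∃ r ∈ P, v * r ∈ Q := by
  classical
  have := h.infinite
  obtain ⟨W, hW⟩ := Infinite.exists_subset_card_eq G (4 * hΔ.toFinset.card)
  have hWne : W.Nonempty := by
    refine Finset.card_pos.1 ?_
    have : 0 < hΔ.toFinset.card := Finset.card_pos.2 ⟨1, hΔ.mem_toFinset.2 h1⟩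
    omega
  obtain ⟨w₀, hw₀⟩ := hWne
  have : Nonempty W := ⟨⟨w₀, hw₀⟩⟩
  let V : Set G := (W : Set G) * (W : Set G)⁻¹ * W
  have hWfin : (W : Set G).Finite := W.finite_toSet
  have hVfin : V.Finite := (hWfin.mul hWfin.inv).mul hWfin
  obtain ⟨q, -, hq⟩ := h.exists_conj_notMem (N := ∅) Set.finite_empty (hVfin.inv.mul hVfin) hΔ
  let P : Set G := (fun v => v * q) '' V
  have hPfin : P.Finite := hVfin.image _
  let U : Set G := P * Δ * P⁻¹
  have hUfin : U.Finite := (hPfin.mul hΔ).mul hPfin.inv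
  let H : Set G := (W : Set G) * (W : Set G)⁻¹
  have hH : ∀ x ∈ H, x⁻¹ ∈ H := by
    rintro _ ⟨a, ha, b, hb, rfl⟩
    exact ⟨b⁻¹, hb, a⁻¹, by simpa using ha, by simp⟩
  have hH1 : (1 : G) ∈ H := ⟨w₀, hw₀, w₀⁻¹, by simpa using hw₀, by simp⟩
  obtain ⟨C, -, hCsep, hCU, hC⟩ := SeparatedBy.exists_maximal (H := H) (N := Uᶜ) (I₀ := ∅) hH1 hH
    (by simp [SeparatedBy]) (by simp)
  have hCfin : C.Finite := hUfin.subset fun c hc => not_not.1 (hCU c hc)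
  have : Fintype C := hCfin.fintype
  let R : C × W → C × W → Prop := fun x y =>
    x.1 ≠ y.1 ∧ ((x.1 : G) * x.2 * q)⁻¹ * (y.1 * y.2 * q) ∈ Δ
  obtain ⟨f, hf⟩ := exists_independent_transversal R
    (by
      rintro x y ⟨hxy, hR⟩
      exact ⟨hxy.symm, by simpa only [mul_inv_rev, inv_inv, mul_assoc] using hinv _ hR⟩)
    hΔ.toFinset.card
    (by
      intro x
      refine Finset.card_le_card_of_injOn
        (fun y => ((x.1 : G) * x.2 * q)⁻¹ * (y.1 * y.2 * q)) ?_ ?_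
      · intro y hy
        simp only [Finset.mem_coe, Finset.mem_filter, Finset.mem_univ, true_and] at hy
        simpa using hy.2
      · rintro ⟨⟨c, hc⟩, ⟨w, hw⟩⟩ - ⟨⟨c', hc'⟩, ⟨w', hw'⟩⟩ - heq
        simp only [mul_right_inj, mul_left_inj] at heq
        have hcc : c = c' := by
          by_contra hne
          refine hCsep c hc c' hc' hne ⟨w, hw, w'⁻¹, by simpa using hw', ?_⟩
          change w * w'⁻¹ = c⁻¹ * c'
          rw [mul_inv_eq_iff_eq_mul, mul_assoc, eq_inv_mul_iff_mul_eq, heq]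
        subst hcc
        have := mul_left_cancel heq
        subst this
        rfl)
    (by simp [hW])
  let Q : Set G := Set.range fun c : C => (c : G) * f c * q
  have hhit : ∀ v ∈ U, ∃ r ∈ P, v * r ∈ Q := by
    intro v hv
    obtain ⟨c, hc, a, ha, b, hb, hab⟩ := hC v (not_not.2 hv)
    refine ⟨(v⁻¹ * c) * f ⟨c, hc⟩ * q, ⟨(v⁻¹ * c) * f ⟨c, hc⟩, ?_, rfl⟩, ⟨⟨c, hc⟩, ?_⟩⟩
    · exact ⟨v⁻¹ * c, ⟨a, ha, b, hb, hab⟩, f ⟨c, hc⟩, (f ⟨c, hc⟩).2, rfl⟩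
    · group
  have hPne : P.Nonempty :=
    ⟨_, w₀ * w₀⁻¹ * w₀, ⟨_, ⟨w₀, hw₀, w₀⁻¹, by simpa using hw₀, rfl⟩, w₀, hw₀, rfl⟩, rfl⟩
  refine ⟨P, Q, hPfin, Set.finite_range _, hPne, ?_, ?_, ?_, hhit⟩
  · obtain ⟨p, hp⟩ := hPne
    obtain ⟨r, -, hr⟩ := hhit (p * 1 * p⁻¹) ⟨_, ⟨p, hp, 1, h1, rfl⟩, p⁻¹, by simpa using hp, rfl⟩
    exact ⟨_, hr⟩
  · rintro _ ⟨v, hv, rfl⟩ _ ⟨v', hv', rfl⟩ hne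
    have hvv : v⁻¹ * v' ≠ 1 := by
      intro h0
      rw [inv_mul_eq_one] at h0
      exact hne (by rw [h0])
    have := hq (v⁻¹ * v') ⟨v⁻¹, by simpa using hv, v', hv', rfl⟩ hvv
    simpa only [mul_inv_rev, mul_assoc] using this
  · rintro _ ⟨c, rfl⟩ _ ⟨c', rfl⟩ hne hΔ'
    have hcc : c ≠ c' := by rintro rfl; exact hne rfl
    exact hf c c' hcc ⟨hcc, hΔ'⟩

theorem IsICC.exists_marker_patterns {G : Type*} [Group G] (h : IsICC G) {Δ : Set G}
    (hΔ : Δ.Finite) (h1 : 1 ∈ Δ) (hinv : ∀ x ∈ Δ, x⁻¹ ∈ Δ) :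
    ∃ P Q T : Set G, P.Finite ∧ Q.Finite ∧ T.Finite ∧ P.Nonempty ∧ Q.Nonempty ∧ T.Nonempty ∧
      SeparatedBy Δ P ∧ SeparatedBy Δ Q ∧
      (∀ v, (∀ t ∈ T, t⁻¹ * v ∈ P * Δ * Q⁻¹) → v = 1) ∧
      ∀ t ∈ T, ∀ v ∈ P * Δ * P⁻¹, ∃ r ∈ P, t * v * r ∈ Q := by
  have := h.infinite
  obtain ⟨P, Q, hP, hQ, hPne, hQne, hPs, hQs, hhit⟩ := h.exists_separated_hitting hΔ h1 hinv
  let F : Set G := P * Δ * Q⁻¹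
  have hF : F.Finite := (hP.mul hΔ).mul hQ.inv
  let D : Set G := Q * Δ * Q⁻¹
  have hD : D.Finite := (hQ.mul hΔ).mul hQ.inv
  obtain ⟨s, hs⟩ := ((hF.mul hF.inv).union hD).exists_notMem
  simp only [Set.mem_union, not_or] at hs
  have hS : ({1, s} : Set G).Finite := Set.toFinite _
  let E : Set G := {1, s} * F * ({1, s} : Set G)⁻¹
  have hE : E.Finite := (hS.mul hF).mul hS.inv
  obtain ⟨t, ht, htE⟩ := h.exists_conj_notMem
    (((hE.mul hS).mul hF.inv).union (hS.mul hD)) hE hF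
  simp only [Set.mem_union, not_or] at ht
  let T : Set G := {1, s, t}
  have hT : T.Finite := Set.toFinite _
  have hcross : ∀ a ∈ T, ∀ b ∈ T, a ≠ b → a⁻¹ * b ∉ D := by
    have hDinv : ∀ x ∈ D, x⁻¹ ∈ D := by
      rintro _ ⟨_, ⟨p, hp, δ, hδ, rfl⟩, r, hr, rfl⟩
      exact ⟨r⁻¹ * δ⁻¹, ⟨r⁻¹, hr, δ⁻¹, hinv _ hδ, rfl⟩, p⁻¹, by simpa using hp, by group⟩
    have h1s : (1 : G)⁻¹ * s ∉ D := by simpa using hs.2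
    have h1t : (1 : G)⁻¹ * t ∉ D := fun hd =>
      ht.2 ⟨1, by simp, _, hd, by group⟩
    have hst : s⁻¹ * t ∉ D := fun hd => ht.2 ⟨s, by simp, _, hd, by group⟩
    have hsym : ∀ a b, a⁻¹ * b ∉ D → b⁻¹ * a ∉ D := fun a b hab hba =>
      hab (by simpa using hDinv _ hba)
    rintro a (rfl | rfl | rfl) b (rfl | rfl | rfl) hab
    · exact absurd rfl hab
    · exact h1s
    · exact h1t
    · exact hsym _ _ h1s
    · exact absurd rfl hab
    · exact hst
    · exact hsym _ _ h1t
    · exact hsym _ _ hst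
    · exact absurd rfl hab
  refine ⟨P, T * Q, T, hP, hT.mul hQ, hT, hPne, Set.Nonempty.mul ⟨1, by simp [T]⟩ hQne,
    ⟨1, by simp [T]⟩,
    hPs, ?_, ?_, ?_⟩
  · rintro _ ⟨a, ha, p, hp, rfl⟩ _ ⟨b, hb, q, hq, rfl⟩ hne hΔ'
    by_cases hab : a = b
    · subst hab
      refine hQs p hp q hq (by rintro rfl; exact hne rfl) ?_
      simpa [mul_assoc] using hΔ'
    · refine hcross a ha b hb hab ⟨p * ((a * p)⁻¹ * (b * q)), ⟨p, hp, _, hΔ', rfl⟩, q⁻¹,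
        by simpa using hq, by group⟩
  · intro v hv
    have hv' : ∀ a ∈ T, ∃ x ∈ F, ∃ b ∈ T, v = a * x * b⁻¹ := by
      intro a ha
      obtain ⟨y, hy, z, hz, hyz⟩ := hv a ha
      obtain ⟨b, hb, q, hq, hbq⟩ := Set.mem_inv.1 hz
      refine ⟨y * q⁻¹, ⟨y, hy, q⁻¹, by simpa using hq, rfl⟩, b, hb, ?_⟩
      simp only at hyz hbq
      rw [eq_inv_mul_iff_mul_eq] at hyz
      rw [← hyz, ← inv_inv z, ← hbq]
      group
    by_contra hv1
    have hvE : v ∉ E := by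
      intro hvE
      obtain ⟨x, hx, b, hb, hvx⟩ := hv' t (by simp [T])
      by_cases hbt : b = t
      · subst hbt
        exact htE v hvE hv1 (by rw [hvx]; simpa [mul_assoc] using hx)
      · have hb' : b ∈ ({1, s} : Set G) := by
          rcases hb with rfl | rfl | rfl
          · simp
          · simp
          · exact absurd rfl hbt
        refine ht.1 ⟨v * b, ⟨v, hvE, b, hb', rfl⟩, x⁻¹, by simpa using hx, ?_⟩
        simp only [hvx]; group
    have hlast : ∀ a ∈ ({1, s} : Set G), ∃ x ∈ F, v = a * x * t⁻¹ := by
      intro a ha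
      obtain ⟨x, hx, b, hb, hvx⟩ := hv' a (by
        rcases ha with rfl | rfl <;> simp [T])
      by_cases hbt : b = t
      · exact ⟨x, hx, by rw [hvx, hbt]⟩
      · have hb' : b ∈ ({1, s} : Set G) := by
          rcases hb with rfl | rfl | rfl
          · simp
          · simp
          · exact absurd rfl hbt
        refine absurd ⟨a * x, ⟨a, ha, x, hx, rfl⟩, b⁻¹, by simpa using hb', hvx.symm⟩ hvE
    obtain ⟨x, hx, hvx⟩ := hlast 1 (by simp)
    obtain ⟨y, hy, hvy⟩ := hlast s (by simp)
    refine hs.1 ⟨x, hx, y⁻¹, by simpa using hy, ?_⟩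
    have := hvx.symm.trans hvy
    simp only [mul_left_inj, one_mul] at this
    simp only [this]; group
  · intro a ha v hv
    obtain ⟨r, hr, hvr⟩ := hhit v hv
    exact ⟨r, hr, a, ha, v * r, hvr, by group⟩

/-- `I` is a maximal `H`-separated subset of the complement of `N`. -/
def MaximalSeparated {G : Type*} [Group G] (H N I : Set G) : Prop :=
  SeparatedBy H I ∧ (∀ c ∈ I, c ∉ N) ∧ ∀ g, g ∉ N → ∃ c ∈ I, g⁻¹ * c ∈ H

theorem MaximalSeparated.exists_glue {G : Type*} [Group G] {H N N₁ N₂ C C' E E' : Set G}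
    (hH1 : 1 ∈ H) (hH : ∀ x ∈ H, x⁻¹ ∈ H) (hC : MaximalSeparated H N₁ C)
    (hC' : MaximalSeparated H N₂ C') (h₁ : ∀ g ∈ E * H, g ∈ N ↔ g ∈ N₁)
    (h₂ : ∀ g ∈ E' * H, g ∈ N ↔ g ∈ N₂) (hd : Disjoint (E * H * H) (E' * H)) :
    ∃ D, MaximalSeparated H N D ∧ (∀ g ∈ E, g ∈ D ↔ g ∈ C) ∧ ∀ g ∈ E', g ∈ D ↔ g ∈ C' := by
  have hcross : ∀ p ∈ E * H, ∀ q ∈ E' * H, p⁻¹ * q ∉ H := fun p hp q hq hpq =>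
    Set.disjoint_left.1 hd ⟨p, hp, _, hpq, by simp⟩ hq
  have hI₀ : SeparatedBy H (C ∩ (E * H) ∪ C' ∩ (E' * H)) := by
    rintro p (⟨hp, hpE⟩ | ⟨hp, hpE⟩) q (⟨hq, hqE⟩ | ⟨hq, hqE⟩) hpq
    · exact hC.1 p hp q hq hpq
    · exact hcross p hpE q hqE
    · exact fun hh => hcross q hqE p hpE (by simpa using hH _ hh)
    · exact hC'.1 p hp q hq hpq
  obtain ⟨D, hsub, hD⟩ := SeparatedBy.exists_maximal (N := N) hH1 hH hI₀ (by
    rintro c (⟨hc, hcE⟩ | ⟨hc, hcE⟩)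
    · exact fun hn => hC.2.1 c hc ((h₁ c hcE).1 hn)
    · exact fun hn => hC'.2.1 c hc ((h₂ c hcE).1 hn))
  have key : ∀ {N₁ C E : Set G}, MaximalSeparated H N₁ C → (∀ g ∈ E * H, g ∈ N ↔ g ∈ N₁) →
      C ∩ (E * H) ⊆ D → ∀ g ∈ E, g ∈ D ↔ g ∈ C := by
    intro N₁ C E hC h₁ hs g hg
    have hg' : g ∈ E * H := ⟨g, hg, 1, hH1, by simp⟩
    refine ⟨fun hgD => ?_, fun hgC => hs ⟨hgC, hg'⟩⟩
    obtain ⟨c, hc, hgc⟩ := hC.2.2 g fun hn => hD.2.1 g hgD ((h₁ g hg').2 hn)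
    by_cases hgc' : g = c
    · exact hgc' ▸ hc
    · exact absurd hgc (hD.1 g hgD c (hs ⟨hc, g, hg, _, hgc, by simp⟩) hgc')
  exact ⟨D, hD, key hC h₁ (Set.subset_union_left.trans hsub),
    key hC' h₂ (Set.subset_union_right.trans hsub)⟩

theorem SeparatedBy.shift {G : Type*} [Group G] {H I : Set G} (h : SeparatedBy H I) (g : G) :
    SeparatedBy H {x | g⁻¹ * x ∈ I} := by
  intro p hp q hq hpq hm
  exact h _ hp _ hq (by simpa using hpq) (by simpa [mul_assoc] using hm)

theorem MaximalSeparated.shift {G : Type*} [Group G] {H N I : Set G}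
    (h : MaximalSeparated H N I) (g : G) :
    MaximalSeparated H {x | g⁻¹ * x ∈ N} {x | g⁻¹ * x ∈ I} := by
  refine ⟨h.1.shift g, fun c hc => h.2.1 _ hc, fun x hx => ?_⟩
  obtain ⟨c, hc, hxc⟩ := h.2.2 _ hx
  exact ⟨g * c, by simpa using hc, by simpa [mul_assoc] using hxc⟩

theorem isClosed_setOf_maximalSeparated {G Z : Type*} [Group G] [TopologicalSpace Z]
    {H : Set G} (hH : H.Finite) {N I : Z → Set G} (hN : ∀ g, IsClopen {z | g ∈ N z})
    (hI : ∀ g, IsClopen {z | g ∈ I z}) : IsClosed {z | MaximalSeparated H (N z) (I z)} := by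
  have himp : ∀ {p q : Z → Prop}, IsClopen {z | p z} → IsClopen {z | q z} →
      IsClopen {z | p z → q z} := fun hp hq => by
    simpa only [imp_iff_not_or, Set.ofPred_or, ← Set.compl_ofPred] using hp.compl.union hq
  refine IsClosed.and ?_ (IsClosed.and ?_ ?_)
  · have : {z | SeparatedBy H (I z)} =
        ⋂ (p : G) (q : G) (_ : p ≠ q) (_ : p⁻¹ * q ∈ H), {z | p ∈ I z → q ∉ I z} := by
      ext z
      simp only [SeparatedBy, Set.mem_ofPred_eq, Set.mem_iInter]
      exact ⟨fun h p q hpq hm hp hq => h p hp q hq hpq hm,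
        fun h p hp q hq hpq hm => h p q hpq hm hp hq⟩
    rw [this]
    exact isClosed_iInter fun p => isClosed_iInter fun q => isClosed_iInter fun _ =>
      isClosed_iInter fun _ => (himp (hI p) (hI q).compl).isClosed
  · simp only [Set.ofPred_forall]
    exact isClosed_iInter fun c => (himp (hI c) (hN c).compl).isClosed
  · simp only [Set.ofPred_forall]
    refine isClosed_iInter fun g => IsClopen.isClosed ?_
    refine himp (hN g).compl ?_
    have : {z | ∃ c ∈ I z, g⁻¹ * c ∈ H} = ⋃ x ∈ H, {z | g * x ∈ I z} := by
      ext z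
      simp only [Set.mem_ofPred_eq, Set.mem_iUnion, exists_prop]
      constructor
      · rintro ⟨c, hc, hgc⟩
        exact ⟨_, hgc, by simpa using hc⟩
      · rintro ⟨x, hx, hgx⟩
        exact ⟨_, hgx, by simpa using hx⟩
    rw [this]
    exact hH.isClopen_biUnion fun x _ => hI _

theorem IsICC.exists_marker_shift {G : Type*} [Group G] (h : IsICC G) {Δ : Set G}
    (hΔ : Δ.Finite) (h1 : 1 ∈ Δ) (hinv : ∀ x ∈ Δ, x⁻¹ ∈ Δ) :
    ∃ Y : Set (G → Bool), IsShift Y ∧ StronglyIrreducible Y ∧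
      (∀ y ∈ Y, SeparatedBy Δ {g | y g = true}) ∧
      ∃ K : Set G, K.Finite ∧ ∀ y ∈ Y, ∀ y' ∈ Y, ∃ m ∈ K, y m = true ∧ y' m = true := by
  classical
  obtain ⟨P, Q, T, hP, hQ, hT, hPne, hQne, hTne, hPs, hQs, hTv, hTr⟩ :=
    h.exists_marker_patterns hΔ h1 hinv
  have hmulinv : ∀ {L : Set G}, ∀ x ∈ L * Δ * L⁻¹, x⁻¹ ∈ L * Δ * L⁻¹ := by
    rintro L _ ⟨_, ⟨p, hp, δ, hδ, rfl⟩, r, hr, rfl⟩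
    exact ⟨r⁻¹ * δ⁻¹, ⟨r⁻¹, hr, δ⁻¹, hinv _ hδ, rfl⟩, p⁻¹, by simpa using hp, by group⟩
  have hone : ∀ {L : Set G}, L.Nonempty → (1 : G) ∈ L * Δ * L⁻¹ := by
    rintro L ⟨p, hp⟩
    exact ⟨_, ⟨p, hp, 1, h1, rfl⟩, p⁻¹, by simpa using hp, by simp⟩
  let Θ : Set G := P * Δ * P⁻¹
  let Φ : Set G := P * Δ * Q⁻¹
  let Ξ : Set G := Q * Δ * Q⁻¹ ∪ (T * Φ)⁻¹ * (T * Φ)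
  have hΘ : Θ.Finite := (hP.mul hΔ).mul hP.inv
  have hΦ : Φ.Finite := (hP.mul hΔ).mul hQ.inv
  have hΞ : Ξ.Finite := ((hQ.mul hΔ).mul hQ.inv).union ((hT.mul hΦ).inv.mul (hT.mul hΦ))
  have hΘ1 : 1 ∈ Θ := hone hPne
  have hΘinv : ∀ x ∈ Θ, x⁻¹ ∈ Θ := hmulinv
  have hΞ1 : 1 ∈ Ξ := Or.inl (hone hQne)
  have hΞinv : ∀ x ∈ Ξ, x⁻¹ ∈ Ξ := by
    rintro x (hx | ⟨a, ha, b, hb, rfl⟩)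
    · exact Or.inl (hmulinv x hx)
    · exact Or.inr ⟨b⁻¹, Set.inv_mem_inv.2 hb, a⁻¹, ha, by simp⟩
  let N : Set G → Set G := fun C => {g | ∃ c ∈ C, g⁻¹ * c ∈ Φ}
  let Good : Set G → Set G → Prop := fun C D =>
    MaximalSeparated Ξ ∅ D ∧ MaximalSeparated Θ (N D) C
  let Y : Set (G → Bool) := {y | ∃ C D, Good C D ∧ ∀ g, y g = true ↔ g ∈ C * P ∪ D * Q}
  have hY : ∀ C D, Good C D → ∃ y ∈ Y, ∀ g, y g = true ↔ g ∈ C * P ∪ D * Q := fun C D hCD =>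
    ⟨fun g => decide (g ∈ C * P ∪ D * Q), ⟨C, D, hCD, by simp⟩, by simp⟩
  have hYne : Y.Nonempty := by
    obtain ⟨D, -, hD⟩ := SeparatedBy.exists_maximal (N := ∅) (I₀ := ∅) hΞ1 hΞinv
      (by simp [SeparatedBy]) (by simp)
    obtain ⟨C, -, hC⟩ := SeparatedBy.exists_maximal (N := N D) (I₀ := ∅) hΘ1 hΘinv
      (by simp [SeparatedBy]) (by simp)
    obtain ⟨y, hy, -⟩ := hY C D ⟨hD, hC⟩
    exact ⟨y, hy⟩
  have hYcl : IsClosed Y := by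
    let Z : Set ((G → Bool) × (G → Bool) × (G → Bool)) :=
      {z | Good {g | z.1 g = true} {g | z.2.1 g = true} ∧
        ∀ g, z.2.2 g = true ↔ g ∈ {g | z.1 g = true} * P ∪ {g | z.2.1 g = true} * Q}
    have hev : ∀ {f : (G → Bool) × (G → Bool) × (G → Bool) → Bool}, Continuous f →
        IsClopen {z | f z = true} := fun hf => (isClopen_discrete {true}).preimage hf
    have hmem : ∀ {L : Set G}, L.Finite → ∀ {f : (G → Bool) × (G → Bool) × (G → Bool) → G → Bool},
        Continuous f → ∀ g, IsClopen {z | g ∈ {g | f z g = true} * L} := by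
      intro L hL f hf g
      have : {z | g ∈ {g | f z g = true} * L} = ⋃ l ∈ L, {z | f z (g * l⁻¹) = true} := by
        ext z
        simp [Set.mem_mul, ← eq_mul_inv_iff_mul_eq, and_comm]
      rw [this]
      exact hL.isClopen_biUnion fun l _ => hev (by fun_prop)
    have hZ : IsClosed Z := by
      refine IsClosed.and (IsClosed.and ?_ ?_) ?_
      · exact isClosed_setOf_maximalSeparated hΞ (fun g => by simp [isClopen_empty])
          fun g => hev (by fun_prop)
      · refine isClosed_setOf_maximalSeparated hΘ (fun g => ?_) fun g => hev (by fun_prop)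
        have : {z : (G → Bool) × (G → Bool) × (G → Bool) | g ∈ N {g | z.2.1 g = true}} =
            {z | g ∈ {g | z.2.1 g = true} * Φ⁻¹} := by
          ext z
          simp only [N, Set.mem_ofPred_eq]
          constructor
          · rintro ⟨c, hc, hgc⟩
            exact ⟨c, hc, (g⁻¹ * c)⁻¹, by simpa using hgc, by simp⟩
          · rintro ⟨c, hc, x, hx, rfl⟩
            exact ⟨c, hc, by simpa using hx⟩
        rw [this]
        exact hmem hΦ.inv (by fun_prop) g
      · simp only [Set.ofPred_forall]
        refine isClosed_iInter fun g => IsClopen.isClosed ?_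
        have ha : IsClopen {z : (G → Bool) × (G → Bool) × (G → Bool) | z.2.2 g = true} :=
          hev (by fun_prop)
        have hb : IsClopen {z : (G → Bool) × (G → Bool) × (G → Bool) |
            g ∈ {g | z.1 g = true} * P ∪ {g | z.2.1 g = true} * Q} :=
          (hmem hP (by fun_prop) g).union (hmem hQ (by fun_prop) g)
        have : {z : (G → Bool) × (G → Bool) × (G → Bool) |
            z.2.2 g = true ↔ g ∈ {g | z.1 g = true} * P ∪ {g | z.2.1 g = true} * Q} =
            ({z | z.2.2 g = true} ∩ {z | g ∈ {g | z.1 g = true} * P ∪ {g | z.2.1 g = true} * Q}) ∪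
            ({z | z.2.2 g = true}ᶜ ∩
              {z | g ∈ {g | z.1 g = true} * P ∪ {g | z.2.1 g = true} * Q}ᶜ) := by
          ext z
          simp only [Set.mem_ofPred_eq, Set.mem_union, Set.mem_inter_iff, Set.mem_compl_iff]
          tauto
        rw [this]
        exact (ha.inter hb).union (ha.compl.inter hb.compl)
    have : Y = (fun z : (G → Bool) × (G → Bool) × (G → Bool) => z.2.2) '' Z := by
      ext y
      constructor
      · rintro ⟨C, D, hCD, hy⟩
        exact ⟨(fun g => decide (g ∈ C), fun g => decide (g ∈ D), y), by simpa [Z] using ⟨hCD, hy⟩,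
          rfl⟩
      · rintro ⟨z, hz, rfl⟩
        exact ⟨_, _, hz.1, hz.2⟩
    rw [this]
    exact (hZ.isCompact.image (by fun_prop)).isClosed
  have hYinv : ∀ y ∈ Y, ∀ g : G, shiftAct g y ∈ Y := by
    rintro y ⟨C, D, ⟨hD, hC⟩, hy⟩ g
    refine ⟨{x | g⁻¹ * x ∈ C}, {x | g⁻¹ * x ∈ D}, ⟨by simpa using hD.shift g, ?_⟩, fun x => ?_⟩
    · convert hC.shift g using 1
      ext x
      constructor
      · rintro ⟨c, hc, hxc⟩
        exact ⟨_, hc, by simpa [mul_assoc] using hxc⟩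
      · rintro ⟨c, hc, hxc⟩
        exact ⟨g * c, by simpa using hc, by simpa [mul_assoc] using hxc⟩
    · have : ∀ L I : Set G, g⁻¹ * x ∈ I * L ↔ x ∈ {x | g⁻¹ * x ∈ I} * L := by
        intro L I
        constructor
        · rintro ⟨c, hc, l, hl, hcl⟩
          exact ⟨g * c, by simpa using hc, l, hl, by
            simp only at hcl ⊢; rw [mul_assoc, hcl]; group⟩
        · rintro ⟨c, hc, l, hl, rfl⟩
          exact ⟨_, hc, l, hl, by simp [mul_assoc]⟩
      simp only [shiftAct, hy, Set.mem_union, this]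
  refine ⟨Y, ⟨hYne, hYcl, hYinv⟩, ?_, ?_, Ξ * Q, hΞ.mul hQ, ?_⟩
  · let M : Set G := P⁻¹ * Θ * Φ ∪ Q⁻¹
    have hM : M.Finite := ((hP.inv.mul hΘ).mul hΦ).union hQ.inv
    let X : Set G := {1} ∪ (M * Ξ * Ξ ∪ M * Ξ ∪ (P⁻¹ * Θ * Θ ∪ P⁻¹ * Θ))
    have hX : X.Finite := (Set.finite_singleton 1).union ((((hM.mul hΞ).mul hΞ).union
      (hM.mul hΞ)).union (((hP.inv.mul hΘ).mul hΘ).union (hP.inv.mul hΘ)))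
    refine ⟨hX.toFinset, by simp [X], fun E E' hEE => ?_⟩
    rw [hX.coe_toFinset] at hEE
    have hdisj : ∀ {L L' : Set G}, L ⊆ X → L' ⊆ X → Disjoint (E * L) (E' * L') := fun hL hL' =>
      (Set.disjoint_iff_inter_eq_empty.2 hEE).mono (Set.mul_subset_mul_left hL)
        (Set.mul_subset_mul_left hL')
    rintro y ⟨C, D, ⟨hD, hC⟩, hy⟩ y' ⟨C', D', ⟨hD', hC'⟩, hy'⟩
    obtain ⟨D₀, hD₀, hD₁, hD₂⟩ := hD.exists_glue (N := ∅) (E := E * M) (E' := E' * M) hΞ1 hΞinv hD'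
      (fun _ _ => Iff.rfl) (fun _ _ => Iff.rfl) (by
        simp only [mul_assoc]
        exact hdisj (fun x hx => by simp only [X, mul_assoc, Set.mem_union]; tauto)
          (fun x hx => by simp only [X, mul_assoc, Set.mem_union]; tauto))
    have hN : ∀ {E D : Set G}, (∀ g ∈ E * M, g ∈ D₀ ↔ g ∈ D) →
        ∀ g ∈ E * P⁻¹ * Θ, g ∈ N D₀ ↔ g ∈ N D := by
      intro E D hD g hg
      refine exists_congr fun c => and_congr_left fun hgc => hD c ?_
      have : c ∈ E * (P⁻¹ * Θ * Φ) := by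
        simp only [← mul_assoc]
        exact ⟨g, hg, _, hgc, by simp⟩
      exact Set.mul_subset_mul_left Set.subset_union_left this
    obtain ⟨C₀, hC₀, hC₁, hC₂⟩ := hC.exists_glue (N := N D₀) (E := E * P⁻¹) (E' := E' * P⁻¹)
      hΘ1 hΘinv hC' (hN hD₁) (hN hD₂) (by
        simp only [mul_assoc]
        exact hdisj (fun x hx => by simp only [X, mul_assoc, Set.mem_union]; tauto)
          (fun x hx => by simp only [X, mul_assoc, Set.mem_union]; tauto))
    obtain ⟨z, hz, hzmem⟩ := hY C₀ D₀ ⟨hD₀, hC₀⟩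
    have hmem : ∀ {I J E L : Set G}, (∀ g ∈ E * L⁻¹, g ∈ I ↔ g ∈ J) →
        ∀ g ∈ E, g ∈ I * L ↔ g ∈ J * L := by
      intro I J E L hIJ g hg
      constructor <;> rintro ⟨c, hc, l, hl, rfl⟩
      · exact ⟨c, (hIJ c ⟨_, hg, l⁻¹, Set.inv_mem_inv.2 hl, by simp⟩).1 hc, l, hl, rfl⟩
      · exact ⟨c, (hIJ c ⟨_, hg, l⁻¹, Set.inv_mem_inv.2 hl, by simp⟩).2 hc, l, hl, rfl⟩
    have hsub : ∀ {E : Set G}, E * Q⁻¹ ⊆ E * M :=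
      fun {E} => Set.mul_subset_mul_left Set.subset_union_right
    refine ⟨z, hz, fun g hg => ?_, fun g hg => ?_⟩
    · rw [Bool.eq_iff_iff, hzmem, hy]
      exact or_congr (hmem hC₁ g hg) (hmem (fun x hx => hD₁ x (hsub hx)) g hg)
    · rw [Bool.eq_iff_iff, hzmem, hy']
      exact or_congr (hmem hC₂ g hg) (hmem (fun x hx => hD₂ x (hsub hx)) g hg)
  · rintro y ⟨C, D, ⟨hD, hC⟩, hy⟩
    have hcd : ∀ c ∈ C, ∀ d ∈ D, ∀ p ∈ P, ∀ q ∈ Q, (c * p)⁻¹ * (d * q) ∉ Δ := by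
      intro c hc d hd p hp q hq hm
      exact hC.2.1 c hc ⟨d, hd, p * ((c * p)⁻¹ * (d * q)), ⟨p, hp, _, hm, rfl⟩, q⁻¹,
        by simpa using hq, by group⟩
    have hsame : ∀ {L I : Set G}, SeparatedBy Δ L → SeparatedBy (L * Δ * L⁻¹) I →
        ∀ c ∈ I, ∀ d ∈ I, ∀ p ∈ L, ∀ q ∈ L, c * p ≠ d * q → (c * p)⁻¹ * (d * q) ∉ Δ := by
      intro L I hL hI c hc d hd p hp q hq hne hm
      by_cases hcd : c = d
      · subst hcd
        exact hL p hp q hq (by rintro rfl; exact hne rfl) (by simpa [mul_assoc] using hm)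
      · exact hI c hc d hd hcd ⟨p * ((c * p)⁻¹ * (d * q)), ⟨p, hp, _, hm, rfl⟩, q⁻¹,
          by simpa using hq, by group⟩
    intro m hm m' hm' hne
    rcases (hy m).1 hm with ⟨c, hc, p, hp, rfl⟩ | ⟨c, hc, p, hp, rfl⟩ <;>
      rcases (hy m').1 hm' with ⟨d, hd, q, hq, rfl⟩ | ⟨d, hd, q, hq, rfl⟩
    · exact hsame hPs hC.1 c hc d hd p hp q hq hne
    · exact hcd c hc d hd p hp q hq
    · exact fun hm => hcd d hd c hc q hq p hp (by simpa using hinv _ hm)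
    · exact hsame hQs (fun a ha b hb hab hm => hD.1 a ha b hb hab (Or.inl hm))
        c hc d hd p hp q hq hne
  · rintro y ⟨C, D, ⟨hD, hC⟩, hy⟩ y' ⟨C', D', ⟨hD', hC'⟩, hy'⟩
    obtain ⟨g, hg, hgΞ⟩ := hD.2.2 1 (by simp)
    rw [inv_one, one_mul] at hgΞ
    by_cases hcase : ∃ t ∈ T, ∃ c ∈ C', (g * t)⁻¹ * c ∈ Θ
    · obtain ⟨t, ht, c, hc, hv⟩ := hcase
      obtain ⟨r, hr, hq⟩ := hTr t ht _ hv
      have hcr : c * r = g * (t * ((g * t)⁻¹ * c) * r) := by group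
      refine ⟨c * r, hcr ▸ ⟨g, hgΞ, _, hq, rfl⟩, (hy _).2 (Or.inr (hcr ▸ ⟨g, hg, _, hq, rfl⟩)),
        (hy' _).2 (Or.inl ⟨c, hc, r, hr, rfl⟩)⟩
    · have hblock : ∀ t ∈ T, ∃ d ∈ D', (g * t)⁻¹ * d ∈ Φ := by
        intro t ht
        by_contra hn
        obtain ⟨c, hc, hv⟩ := hC'.2.2 (g * t) hn
        exact hcase ⟨t, ht, c, hc, hv⟩
      have hsame : ∀ t ∈ T, ∀ s ∈ T, ∀ d ∈ D', ∀ d' ∈ D', (g * t)⁻¹ * d ∈ Φ →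
          (g * s)⁻¹ * d' ∈ Φ → d = d' := by
        intro t ht s hs d hd d' hd' hv hv'
        by_contra hne
        refine hD'.1 d hd d' hd' hne (Or.inr ⟨(t * ((g * t)⁻¹ * d))⁻¹, ?_,
          s * ((g * s)⁻¹ * d'), ⟨s, hs, _, hv', rfl⟩, by group⟩)
        rw [Set.inv_mem_inv]
        exact ⟨t, ht, _, hv, rfl⟩
      obtain ⟨t, ht⟩ := hTne
      obtain ⟨d, hd, hv⟩ := hblock t ht
      have hgd : g⁻¹ * d = 1 := hTv _ fun s hs => by
        obtain ⟨d', hd', hv'⟩ := hblock s hs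
        rw [hsame t ht s hs d hd d' hd' hv hv']
        change s⁻¹ * (g⁻¹ * d') ∈ Φ
        simpa only [mul_inv_rev, mul_assoc] using hv'
      obtain ⟨q, hq⟩ := hQne
      rw [inv_mul_eq_one] at hgd
      exact ⟨g * q, ⟨g, hgΞ, q, hq, rfl⟩, (hy _).2 (Or.inr ⟨g, hg, q, hq, rfl⟩),
        (hy' _).2 (Or.inr ⟨g, hgd ▸ hd, q, hq, rfl⟩)⟩

theorem IsClosed.exists_glue {G A ι : Type*} [Group G] [TopologicalSpace A] [DiscreteTopology A]
    [Finite A] {S : Set (G → A)} (hS : IsClosed S) (hne : S.Nonempty) {X : Set G}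
    (hX : ∀ E₁ E₂ : Set G, (E₁ * X) ∩ (E₂ * X) = ∅ →
      ∀ s₁ ∈ S, ∀ s₂ ∈ S, ∃ s ∈ S, (∀ a ∈ E₁, s a = s₁ a) ∧ ∀ a ∈ E₂, s a = s₂ a)
    (E : ι → Set G) (s : ι → G → A) (hs : ∀ i, s i ∈ S)
    (hd : ∀ i j, i ≠ j → Disjoint (E i * X) (E j * X)) :
    ∃ x ∈ S, ∀ i, ∀ a ∈ E i, x a = s i a := by
  classical
  have hfin : ∀ I : Finset ι, ∃ x ∈ S, ∀ i ∈ I, ∀ a ∈ E i, x a = s i a := by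
    intro I
    induction I using Finset.induction_on with
    | empty => exact ⟨_, hne.some_mem, by simp⟩
    | insert i I hi ih =>
      obtain ⟨x, hx, hxI⟩ := ih
      obtain ⟨z, hz, hz₁, hz₂⟩ := hX (E i) (⋃ j ∈ I, E j) (by
        rw [← Set.disjoint_iff_inter_eq_empty]
        simp only [Set.iUnion_mul, Set.disjoint_iUnion_right]
        exact fun j hj => hd i j (by rintro rfl; exact hi hj)) _ (hs i) x hx
      refine ⟨z, hz, fun j hj a ha => ?_⟩
      rcases Finset.mem_insert.1 hj with rfl | hj
      · exact hz₁ a ha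
      · rw [hz₂ a (by simpa using ⟨j, hj, ha⟩), hxI j hj a ha]
  have hcl : ∀ I : Finset ι, IsClosed {x ∈ S | ∀ i ∈ I, ∀ a ∈ E i, x a = s i a} := by
    intro I
    refine IsClosed.and hS ?_
    simp only [Set.ofPred_forall]
    exact isClosed_iInter fun i => isClosed_iInter fun _ => isClosed_iInter fun a =>
      isClosed_iInter fun _ => isClosed_eq (continuous_apply a) continuous_const
  obtain ⟨x, hx⟩ := IsCompact.nonempty_iInter_of_directed_nonempty_isCompact_isClosed
    (fun I : Finset ι => {x ∈ S | ∀ i ∈ I, ∀ a ∈ E i, x a = s i a})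
    (directed_of_isDirected_le fun I J hIJ x hx => ⟨hx.1, fun i hi =>
      hx.2 i (Finset.mem_of_subset hIJ hi)⟩)
    (fun I => let ⟨x, hx, hxI⟩ := hfin I; ⟨x, hx, hxI⟩) (fun I => (hcl I).isCompact) hcl
  simp only [Set.mem_iInter] at hx
  exact ⟨x, (hx ∅).1, fun i => (hx {i}).2 i (by simp)⟩

theorem exists_separatedBy_injective {G ι : Type*} [Group G] [Infinite G] [Countable ι]
    {H : Set G} (hH : H.Finite) (hH1 : 1 ∈ H) (hinv : ∀ x ∈ H, x⁻¹ ∈ H) :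
    ∃ g : ι → G, ∀ i j, i ≠ j → (g i)⁻¹ * g j ∉ H := by
  obtain ⟨I, -, hI, -, hmax⟩ := SeparatedBy.exists_maximal (N := ∅) (I₀ := ∅) hH1 hinv
    (by simp [SeparatedBy]) (by simp)
  have : Infinite I := by
    refine Set.infinite_coe_iff.2 fun hfin => Set.infinite_univ ((hfin.mul hH).subset fun g _ => ?_)
    obtain ⟨c, hc, hgc⟩ := hmax g (by simp)
    exact ⟨c, hc, _, hinv _ hgc, by simp⟩
  obtain ⟨f, hf⟩ := exists_injective_nat ι
  refine ⟨fun i => Infinite.natEmbedding I (f i), fun i j hij =>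
    hI _ (Subtype.prop _) _ (Subtype.prop _) fun heq => hij (hf ?_)⟩
  exact (Infinite.natEmbedding I).injective (Subtype.ext heq)

/-- A configuration containing all the `F`-patterns of a strongly irreducible shift. -/
theorem StronglyIrreducible.exists_pattern_rich {G A : Type*} [Group G] [Infinite G]
    [TopologicalSpace A] [DiscreteTopology A] [Finite A] {S : Set (G → A)} (hS : IsShift S)
    (hSI : StronglyIrreducible S) {F : Set G} (hF : F.Finite) :
    ∃ w ∈ S, ∃ L : Set G, L.Finite ∧ ∀ s ∈ S, ∃ l ∈ L, ∀ a ∈ F, w (l * a) = s a := by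
  classical
  obtain ⟨X, hX1, hX⟩ := hSI
  obtain ⟨s₀, hs₀⟩ := hS.1
  have : Finite F := hF
  let H : Set G := insert 1 (F * X * (F * X)⁻¹)
  have hH : H.Finite := ((hF.mul X.finite_toSet).mul (hF.mul X.finite_toSet).inv).insert 1
  obtain ⟨g, hg⟩ := exists_separatedBy_injective (ι := F → A) hH (Set.mem_insert _ _) (by
    rintro x (rfl | ⟨a, ha, b, hb, rfl⟩)
    · simp [H]
    · exact Or.inr ⟨b⁻¹, hb, a⁻¹, Set.inv_mem_inv.2 ha, by simp⟩)
  have hrep : ∀ i : F → A, ∃ s ∈ S, (∃ t ∈ S, ∀ a : F, t a = i a) → ∀ a : F, s a = i a := by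
    intro i
    by_cases h : ∃ t ∈ S, ∀ a : F, t a = i a
    · obtain ⟨t, ht, hti⟩ := h
      exact ⟨t, ht, fun _ => hti⟩
    · exact ⟨s₀, hs₀, fun h' => absurd h' h⟩
  choose r hrS hr using hrep
  obtain ⟨w, hw, hwi⟩ := hS.2.1.exists_glue hS.1 hX (fun i => {g i} * F)
    (fun i => shiftAct (g i) (r i)) (fun i => hS.2.2 _ (hrS i) _) (by
      intro i j hij
      rw [Set.disjoint_left]
      rintro _ ⟨_, ⟨_, rfl, a, ha, rfl⟩, x, hx, rfl⟩ ⟨_, ⟨_, rfl, b, hb, rfl⟩, z, hz, heq⟩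
      refine hg i j hij (Or.inr ⟨a * x, ⟨a, ha, x, hx, rfl⟩, (b * z)⁻¹,
        Set.inv_mem_inv.2 ⟨b, hb, z, hz, rfl⟩, ?_⟩)
      simp only [mul_assoc] at heq ⊢
      rw [eq_inv_mul_iff_mul_eq, ← mul_assoc, ← mul_assoc, mul_inv_eq_iff_eq_mul]
      simpa [mul_assoc] using heq.symm)
  refine ⟨w, hw, Set.range g, Set.finite_range g, fun s hs => ?_⟩
  refine ⟨_, ⟨fun a : F => s a, rfl⟩, fun a ha => ?_⟩
  rw [hwi (fun a : F => s a) _ ⟨_, rfl, a, ha, rfl⟩]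
  simpa [shiftAct] using hr (fun a : F => s a) ⟨s, hs, fun _ => rfl⟩ ⟨a, ha⟩

theorem StronglyIrreducible.exists_subshift {G A : Type*} [Group G] [TopologicalSpace A]
    [DiscreteTopology A] [Finite A] (hG : IsICC G) {S : Set (G → A)} (hS : IsShift S)
    (hSI : StronglyIrreducible S) {F : Set G} (hF : F.Finite) :
    ∃ S' : Set (G → A), IsShift S' ∧ StronglyIrreducible S' ∧ AgreeOn F S S' ∧
      ∃ K : Set G, K.Finite ∧ ∀ s ∈ S', ∀ t ∈ S', ∀ u ∈ S', ∃ g ∈ K, ∀ a ∈ F,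
        shiftAct g s a = u a ∧ shiftAct g t a = u a := by
  classical
  have := hG.infinite
  obtain ⟨w, hw, L, hL, hwL⟩ := hSI.exists_pattern_rich hS hF
  obtain ⟨X₀, hX1, hX⟩ := hSI
  let X : Set G := X₀
  have hXfin : X.Finite := X₀.finite_toSet
  let D : Set G := insert 1 (L * F)
  have hD : D.Finite := (hL.mul hF).insert 1
  let Δ : Set G := D * X * (D * X)⁻¹
  have hΔ : Δ.Finite := (hD.mul hXfin).mul (hD.mul hXfin).inv
  have hΔ1 : 1 ∈ Δ := ⟨1 * 1, ⟨1, Set.mem_insert _ _, 1, hX1, rfl⟩, (1 * 1)⁻¹,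
    Set.inv_mem_inv.2 ⟨1, Set.mem_insert _ _, 1, hX1, rfl⟩, by simp⟩
  obtain ⟨Y, hY, ⟨X', hX'1, hX'⟩, hYsep, K, hK, hYK⟩ := hG.exists_marker_shift hΔ hΔ1 (by
    rintro x ⟨a, ha, b, hb, rfl⟩
    exact ⟨b⁻¹, hb, a⁻¹, Set.inv_mem_inv.2 ha, by simp⟩)
  let Z : Set ((G → A) × (G → Bool)) :=
    {z | z.1 ∈ S ∧ z.2 ∈ Y ∧ ∀ m, ∀ d ∈ D, z.2 m = true → z.1 (m * d) = w d}
  let S' : Set (G → A) := Prod.fst '' Z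
  have hS'mem : ∀ s ∈ S', ∃ y ∈ Y, ∀ m, y m = true → ∀ d ∈ D, s (m * d) = w d := by
    rintro _ ⟨z, hz, rfl⟩
    exact ⟨z.2, hz.2.1, fun m hm d hd => hz.2.2 m d hd hm⟩
  have hZcl : IsClosed Z := by
    refine IsClosed.and (hS.2.1.preimage continuous_fst)
      (IsClosed.and (hY.2.1.preimage continuous_snd) ?_)
    simp only [Set.ofPred_forall]
    refine isClosed_iInter fun m => isClosed_iInter fun d => isClosed_iInter fun _ => ?_
    refine isClosed_imp ?_ ?_
    · exact (isOpen_discrete {true}).preimage (by fun_prop : Continuous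
        fun z : (G → A) × (G → Bool) => z.2 m)
    · exact isClosed_eq (by fun_prop) continuous_const
  have hsep : ∀ y ∈ Y, ∀ m m', y m = true → y m' = true → m ≠ m' →
      Disjoint ({m} * D * X) ({m'} * D * X) := by
    intro y hy m m' hm hm' hne
    rw [Set.disjoint_left]
    rintro _ ⟨_, ⟨_, rfl, d, hd, rfl⟩, x, hx, rfl⟩ ⟨_, ⟨_, rfl, d', hd', rfl⟩, x', hx', heq⟩
    refine hYsep y hy _ hm _ hm' hne ⟨d * x, ⟨d, hd, x, hx, rfl⟩, (d' * x')⁻¹,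
      Set.inv_mem_inv.2 ⟨d', hd', x', hx', rfl⟩, ?_⟩
    simp only [mul_assoc] at heq ⊢
    rw [eq_inv_mul_iff_mul_eq, ← mul_assoc, ← mul_assoc, mul_inv_eq_iff_eq_mul]
    simpa [mul_assoc] using heq.symm
  have hS'ne : S'.Nonempty := by
    obtain ⟨y, hy⟩ := hY.1
    obtain ⟨x, hx, hxE⟩ := hS.2.1.exists_glue hS.1 hX
      (fun m : {m // y m = true} => {(m : G)} * D) (fun m => shiftAct m w)
      (fun m => hS.2.2 _ hw _) fun i j hij =>
        hsep y hy _ _ i.2 j.2 fun h => hij (Subtype.ext h)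
    refine ⟨x, (x, y), ⟨hx, hy, fun m d hd hm => ?_⟩, rfl⟩
    refine (hxE ⟨m, hm⟩ (m * d) ⟨_, rfl, d, hd, rfl⟩).trans ?_
    simp [shiftAct]
  have hS'inv : ∀ s ∈ S', ∀ g : G, shiftAct g s ∈ S' := by
    rintro _ ⟨z, ⟨h₁, h₂, h₃⟩, rfl⟩ g
    refine ⟨(shiftAct g z.1, shiftAct g z.2), ⟨hS.2.2 _ h₁ g, hY.2.2 _ h₂ g, ?_⟩, rfl⟩
    intro m d hd hm
    simpa [shiftAct, mul_assoc] using h₃ _ d hd hm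
  have hS'S : S' ⊆ S := by
    rintro _ ⟨z, hz, rfl⟩
    exact hz.1
  have hwD : ∀ l ∈ L, ∀ a ∈ F, l * a ∈ D := fun l hl a ha => Or.inr ⟨l, hl, a, ha, rfl⟩
  refine ⟨S', ⟨hS'ne, (hZcl.isCompact.image continuous_fst).isClosed, hS'inv⟩, ?_, ?_,
    (K * L)⁻¹, (hK.mul hL).inv, ?_⟩
  · let B : Set G := X * X⁻¹ * D⁻¹
    have hR : (X ∪ B * (X' : Set G)).Finite :=
      hXfin.union (((hXfin.mul hXfin.inv).mul hD.inv).mul X'.finite_toSet)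
    refine ⟨hR.toFinset, by simpa [X] using Or.inl hX1, fun E₁ E₂ hE s₁ hs₁ s₂ hs₂ => ?_⟩
    rw [hR.coe_toFinset, ← Set.disjoint_iff_inter_eq_empty] at hE
    have hEX : Disjoint (E₁ * X) (E₂ * X) := hE.mono
      (Set.mul_subset_mul_left Set.subset_union_left)
      (Set.mul_subset_mul_left Set.subset_union_left)
    have hEB : Disjoint (E₁ * B * (X' : Set G)) (E₂ * B * (X' : Set G)) := by
      simp only [mul_assoc _ B]
      exact hE.mono (Set.mul_subset_mul_left Set.subset_union_right)
        (Set.mul_subset_mul_left Set.subset_union_right)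
    have hEB' : Disjoint (E₁ * B) (E₂ * B) := hEB.mono
      (Set.subset_mul_left _ hX'1) (Set.subset_mul_left _ hX'1)
    obtain ⟨y₁, hy₁, hsy₁⟩ := hS'mem s₁ hs₁
    obtain ⟨y₂, hy₂, hsy₂⟩ := hS'mem s₂ hs₂
    obtain ⟨y, hy, hyy₁, hyy₂⟩ := hX' (E₁ * B) (E₂ * B)
      (Set.disjoint_iff_inter_eq_empty.1 hEB) y₁ hy₁ y₂ hy₂
    let V : Bool ⊕ G → Set G := Sum.elim (fun b => bif b then E₁ else E₂) fun _ => ∅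
    let M : Bool ⊕ G → Set G := Sum.elim
      (fun b => {m | y m = true ∧ m ∈ (bif b then E₁ else E₂) * B})
      fun m => {m' | m' = m ∧ y m = true ∧ m ∉ E₁ * B ∧ m ∉ E₂ * B}
    have hMy : ∀ i, ∀ m ∈ M i, y m = true := by
      rintro (b | n) m hm
      · exact hm.1
      · exact hm.1 ▸ hm.2.1
    have hVV : ∀ i j, i ≠ j → Disjoint (V i * X) (V j * X) := by
      rintro ((_ | _) | _) ((_ | _) | _) hij <;> simp_all [V, hEX.symm]
    have hMM : ∀ i j, i ≠ j → ∀ m ∈ M i, m ∉ M j := by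
      have h := Set.disjoint_left.1 hEB'
      rintro ((_ | _) | _) ((_ | _) | _) hij m hm hm'
      all_goals simp only [M, Sum.elim_inl, Sum.elim_inr, Set.mem_ofPred_eq, cond_true,
        cond_false] at hm hm'
      · exact hij rfl
      · exact h hm'.2 hm.2
      · exact hm'.2.2.2 (hm'.1 ▸ hm.2)
      · exact h hm.2 hm'.2
      · exact hij rfl
      · exact hm'.2.2.1 (hm'.1 ▸ hm.2)
      · exact hm.2.2.2 (hm.1 ▸ hm'.2)
      · exact hm.2.2.1 (hm.1 ▸ hm'.2)
      · exact hij (by rw [← hm.1, ← hm'.1])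
    have hVM : ∀ i j, i ≠ j → ∀ m ∈ M j, m ∉ V i * B := by
      have h := Set.disjoint_left.1 hEB'
      rintro ((_ | _) | _) ((_ | _) | _) hij m hm hm'
      all_goals simp only [M, V, Sum.elim_inl, Sum.elim_inr, Set.mem_ofPred_eq, cond_true,
        cond_false, Set.empty_mul, Set.mem_empty_iff_false] at hm hm'
      · exact hij rfl
      · exact h hm.2 hm'
      · exact hm.2.2.2 (hm.1 ▸ hm')
      · exact h hm' hm.2
      · exact hij rfl
      · exact hm.2.2.1 (hm.1 ▸ hm')
    have hVM' : ∀ i j, i ≠ j → Disjoint (V i * X) (M j * D * X) := by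
      intro i j hij
      rw [Set.disjoint_left]
      rintro _ ⟨v, hv, x, hx, rfl⟩ ⟨_, ⟨m, hm, d, hd, rfl⟩, x', hx', heq⟩
      refine hVM i j hij m hm ⟨v, hv, x * x'⁻¹ * d⁻¹, ⟨_, ⟨x, hx, _, Set.inv_mem_inv.2 hx', rfl⟩,
        _, Set.inv_mem_inv.2 hd, rfl⟩, ?_⟩
      simp only [← mul_assoc] at heq ⊢
      rw [← heq]
      group
    have hMM' : ∀ i j, i ≠ j → Disjoint (M i * D * X) (M j * D * X) := by
      intro i j hij
      rw [Set.disjoint_left]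
      rintro _ ⟨_, ⟨m, hm, d, hd, rfl⟩, x, hx, rfl⟩ ⟨_, ⟨m', hm', d', hd', rfl⟩, x', hx', heq⟩
      exact Set.disjoint_left.1 (hsep y hy m m' (hMy _ _ hm) (hMy _ _ hm')
        (by rintro rfl; exact hMM i j hij m hm hm')) ⟨_, ⟨_, rfl, d, hd, rfl⟩, x, hx, rfl⟩
        ⟨_, ⟨_, rfl, d', hd', rfl⟩, x', hx', heq⟩
    obtain ⟨x, hx, hxE⟩ := hS.2.1.exists_glue hS.1 hX (fun i => V i ∪ M i * D)
      (Sum.elim (fun b => bif b then s₁ else s₂) fun m => shiftAct m w) (by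
        rintro ((_ | _) | _)
        · exact hS'S hs₂
        · exact hS'S hs₁
        · exact hS.2.2 _ hw _) (by
        intro i j hij
        simp only [Set.union_mul, Set.disjoint_union_left, Set.disjoint_union_right]
        exact ⟨⟨hVV i j hij, (hVM' j i hij.symm).symm⟩, hVM' i j hij, hMM' i j hij⟩)
    refine ⟨x, ⟨(x, y), ⟨hx, hy, fun m d hd hm => ?_⟩, rfl⟩,
      fun a ha => hxE (.inl true) a (.inl ha),
      fun a ha => hxE (.inl false) a (.inl ha)⟩
    change y m = true at hm
    by_cases hm₁ : m ∈ E₁ * B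
    · refine (hxE (.inl true) (m * d) (.inr ⟨m, ⟨hm, hm₁⟩, d, hd, rfl⟩)).trans ?_
      exact hsy₁ m (hyy₁ m hm₁ ▸ hm) d hd
    by_cases hm₂ : m ∈ E₂ * B
    · refine (hxE (.inl false) (m * d) (.inr ⟨m, ⟨hm, hm₂⟩, d, hd, rfl⟩)).trans ?_
      exact hsy₂ m (hyy₂ m hm₂ ▸ hm) d hd
    · refine (hxE (.inr m) (m * d) (.inr ⟨m, ⟨rfl, hm, hm₁, hm₂⟩, d, hd, rfl⟩)).trans ?_
      simp [shiftAct]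
  · intro p
    constructor
    · rintro ⟨s, hs, hsp⟩
      obtain ⟨l, hl, hls⟩ := hwL s hs
      obtain ⟨x, hx⟩ := hS'ne
      obtain ⟨y, hy, hxy⟩ := hS'mem x hx
      obtain ⟨m, -, hm, -⟩ := hYK y hy y hy
      refine ⟨_, hS'inv x hx (m * l)⁻¹, fun a ha => ?_⟩
      rw [← hsp a ha, ← hls a ha, ← hxy m hm _ (hwD l hl a ha)]
      simp [shiftAct, mul_assoc]
    · rintro ⟨s, hs, hsp⟩
      exact ⟨s, hS'S hs, hsp⟩
  · intro s hs t ht u hu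
    obtain ⟨l, hl, hlu⟩ := hwL u (hS'S hu)
    obtain ⟨y, hy, hsy⟩ := hS'mem s hs
    obtain ⟨y', hy', hty⟩ := hS'mem t ht
    obtain ⟨m, hmK, hm, hm'⟩ := hYK y hy y' hy'
    refine ⟨(m * l)⁻¹, Set.inv_mem_inv.2 ⟨m, hmK, l, hl, rfl⟩, fun a ha => ?_⟩
    rw [← hlu a ha]
    constructor
    · rw [← hsy m hm _ (hwD l hl a ha)]
      simp [shiftAct, mul_assoc]
    · rw [← hty m hm' _ (hwD l hl a ha)]
      simp [shiftAct, mul_assoc]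

theorem nhds_basis_eq_on_finite {G A : Type*} [TopologicalSpace A] [DiscreteTopology A]
    (z : G → A) : (𝓝 z).HasBasis (fun F : Set G => F.Finite) fun F => {x | ∀ a ∈ F, x a = z a} := by
  refine ⟨fun t => ?_⟩
  rw [nhds_pi, Filter.mem_pi]
  constructor
  · rintro ⟨I, hI, u, hu, hsub⟩
    exact ⟨I, hI, fun x hx => hsub fun a ha => by
      rw [hx a ha]
      exact mem_of_mem_nhds (hu a)⟩
  · rintro ⟨F, hF, hsub⟩
    exact ⟨F, hF, fun a => {z a}, fun a => by simp, fun x hx => hsub fun a ha => hx a ha⟩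

theorem mem_closure_iff_eq_on_finite {G A : Type*} [TopologicalSpace A] [DiscreteTopology A]
    {S : Set (G → A)} {z : G → A} :
    z ∈ closure S ↔ ∀ F : Set G, F.Finite → ∃ s ∈ S, ∀ a ∈ F, s a = z a :=
  mem_closure_iff_nhds_basis (nhds_basis_eq_on_finite z)

theorem exists_finite_eq_on {G A : Type*} [Finite A] {F : Set G} (hF : F.Finite) :
    ∃ R : Set (G → A), R.Finite ∧ ∀ p : G → A, ∃ r ∈ R, ∀ a ∈ F, r a = p a := by
  classical
  have : Finite F := hF
  rcases isEmpty_or_nonempty (G → A) with h | ⟨⟨p₀⟩⟩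
  · exact ⟨∅, Set.finite_empty, fun p => (h.false p).elim⟩
  · refine ⟨Set.range fun (i : F → A) a => if h : a ∈ F then i ⟨a, h⟩ else p₀ a,
      Set.finite_range _, fun p => ⟨_, ⟨fun a => p a, rfl⟩, fun a ha => ?_⟩⟩
    simp [ha]

namespace AgreeOn

variable {G A : Type*} {F F' : Set G} {S T U : Set (G → A)}

theorem rfl : AgreeOn F S S := fun _ => Iff.rfl

theorem symm (h : AgreeOn F S T) : AgreeOn F T S := fun p => (h p).symm

theorem trans (h : AgreeOn F S T) (h' : AgreeOn F T U) : AgreeOn F S U :=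
  fun p => (h p).trans (h' p)

theorem exists_eq_on (h : AgreeOn F S T) {s : G → A} (hs : s ∈ S) :
    ∃ t ∈ T, ∀ a ∈ F, t a = s a :=
  (h s).1 ⟨s, hs, fun _ _ => Eq.refl _⟩

theorem mono (hF : F ⊆ F') (h : AgreeOn F' S T) : AgreeOn F S T := by
  refine fun p => ⟨?_, ?_⟩
  · rintro ⟨s, hs, hsp⟩
    obtain ⟨t, ht, hts⟩ := h.exists_eq_on hs
    exact ⟨t, ht, fun a ha => (hts a (hF ha)).trans (hsp a ha)⟩
  · rintro ⟨s, hs, hsp⟩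
    obtain ⟨t, ht, hts⟩ := h.symm.exists_eq_on hs
    exact ⟨t, ht, fun a ha => (hts a (hF ha)).trans (hsp a ha)⟩

end AgreeOn

section ShiftSpace

variable {G A : Type*} {e : ℕ → G}

theorem finite_setOf_exists_lt (e : ℕ → G) (n : ℕ) : {g | ∃ k < n, e k = g}.Finite :=
  (Set.finite_Iio n).image e

theorem setOf_exists_lt_mono (e : ℕ → G) {m n : ℕ} (h : m ≤ n) :
    {g | ∃ k < m, e k = g} ⊆ {g | ∃ k < n, e k = g} :=
  fun _ ⟨k, hk, hg⟩ => ⟨k, hk.trans_le h, hg⟩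

theorem Function.Surjective.exists_subset_setOf_lt (he : Function.Surjective e) {F : Set G}
    (hF : F.Finite) : ∃ n, F ⊆ {g | ∃ k < n, e k = g} := by
  induction F, hF using Set.Finite.induction_on with
  | empty => exact ⟨0, Set.empty_subset _⟩
  | @insert a F _ _ ih =>
    obtain ⟨n, hn⟩ := ih
    obtain ⟨k, rfl⟩ := he a
    refine ⟨max (k + 1) n, Set.insert_subset ⟨k, by simp, rfl⟩
      (hn.trans (setOf_exists_lt_mono e (le_max_right _ _)))⟩

variable [Group G] [TopologicalSpace A] [DiscreteTopology A]

theorem ShiftSpace.eq_of_forall_agreeOn (he : Function.Surjective e) {S T : ShiftSpace G A}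
    (h : ∀ n, AgreeOn {g | ∃ k < n, e k = g} S.1 T.1) : S = T := by
  have key : ∀ {S T : ShiftSpace G A}, (∀ n, AgreeOn {g | ∃ k < n, e k = g} S.1 T.1) →
      S.1 ⊆ T.1 := by
    intro S T h s hs
    rw [← T.2.2.1.closure_eq, mem_closure_iff_eq_on_finite]
    intro F hF
    obtain ⟨n, hn⟩ := he.exists_subset_setOf_lt hF
    exact ((h n).mono hn).exists_eq_on hs
  exact Subtype.ext ((key h).antisymm (key fun n => (h n).symm))

theorem ShiftSpace.agreeOn_iff_le_sSup (he : Function.Surjective e) {S T : ShiftSpace G A}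
    (hne : S ≠ T) (n : ℕ) : AgreeOn {g | ∃ k < n, e k = g} S.1 T.1 ↔
      n ≤ sSup {n : ℕ | AgreeOn {g | ∃ k < n, e k = g} S.1 T.1} := by
  have hbdd : BddAbove {n : ℕ | AgreeOn {g | ∃ k < n, e k = g} S.1 T.1} := by
    by_contra h
    refine hne (eq_of_forall_agreeOn he fun n => ?_)
    obtain ⟨m, hm, hnm⟩ := not_bddAbove_iff.1 h n
    exact AgreeOn.mono (setOf_exists_lt_mono e hnm.le) hm
  have hmem := Nat.sSup_mem (s := {n : ℕ | AgreeOn {g | ∃ k < n, e k = g} S.1 T.1})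
    ⟨0, fun p => by
      simp only [Nat.not_lt_zero, false_and, exists_false, Set.mem_ofPred_eq, false_implies,
        implies_true, and_true]
      exact ⟨fun _ => T.2.1, fun _ => S.2.1⟩⟩ hbdd
  exact ⟨fun h => le_csSup hbdd h, fun h => AgreeOn.mono (setOf_exists_lt_mono e h) hmem⟩

theorem shiftSpaceDist_le (he : Function.Surjective e) {S T : ShiftSpace G A} {n : ℕ}
    (h : AgreeOn {g | ∃ k < n, e k = g} S.1 T.1) : shiftSpaceDist e S T ≤ 1 / ((n : ℝ) + 1) := by
  unfold shiftSpaceDist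
  split_ifs with hST
  · positivity
  · have := (ShiftSpace.agreeOn_iff_le_sSup he hST n).1 h
    gcongr

theorem exists_agreeOn_of_shiftSpaceDist_lt (he : Function.Surjective e) {S T : ShiftSpace G A}
    {ε : ℝ} (hε : 0 < ε) (h : shiftSpaceDist e S T < ε) :
    ∃ n : ℕ, AgreeOn {g | ∃ k < n, e k = g} S.1 T.1 ∧ 1 / ((n : ℝ) + 1) < ε := by
  by_cases hST : S = T
  · obtain ⟨n, hn⟩ := exists_nat_one_div_lt hε
    exact ⟨n, hST ▸ AgreeOn.rfl, hn⟩
  · rw [shiftSpaceDist, if_neg hST] at h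
    exact ⟨_, (ShiftSpace.agreeOn_iff_le_sSup he hST _).2 le_rfl, h⟩

theorem isOpen_shiftSpaceTopology_iff (he : Function.Surjective e) {U : Set (ShiftSpace G A)} :
    IsOpen[shiftSpaceTopology G A e] U ↔
      ∀ S ∈ U, ∃ n, {T : ShiftSpace G A | AgreeOn {g | ∃ k < n, e k = g} S.1 T.1} ⊆ U := by
  constructor
  · intro h
    induction h with
    | basic U hU =>
      obtain ⟨S, ε, hε, rfl⟩ := hU
      intro T hT
      obtain ⟨n, hn, hnε⟩ := exists_agreeOn_of_shiftSpaceDist_lt he hε hT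
      exact ⟨n, fun T' hT' => (shiftSpaceDist_le he (hn.trans hT')).trans_lt hnε⟩
    | univ => exact fun _ _ => ⟨0, Set.subset_univ _⟩
    | inter U V _ _ hU hV =>
      rintro S ⟨hSU, hSV⟩
      obtain ⟨m, hm⟩ := hU S hSU
      obtain ⟨n, hn⟩ := hV S hSV
      exact ⟨max m n, fun T hT =>
        ⟨hm (AgreeOn.mono (setOf_exists_lt_mono e (le_max_left _ _)) hT),
          hn (AgreeOn.mono (setOf_exists_lt_mono e (le_max_right _ _)) hT)⟩⟩
    | sUnion 𝒰 _ h =>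
      rintro S ⟨U, hU, hS⟩
      obtain ⟨n, hn⟩ := h U hU S hS
      exact ⟨n, hn.trans (Set.subset_sUnion_of_mem hU)⟩
  · intro h
    let := shiftSpaceTopology G A e
    have hball : ∀ (S : ShiftSpace G A) (n : ℕ),
        IsOpen {T : ShiftSpace G A | shiftSpaceDist e S T < 1 / ((n : ℝ) + 1 / 2)} := fun S n =>
      TopologicalSpace.isOpen_generateFrom_of_mem ⟨S, _, by positivity, rfl⟩
    refine isOpen_iff_forall_mem_open.2 fun S hS => ?_
    obtain ⟨n, hn⟩ := h S hS
    refine ⟨_, fun T hT => hn ?_, hball S n, ?_⟩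
    · obtain ⟨m, hm, hmn⟩ := exists_agreeOn_of_shiftSpaceDist_lt he (by positivity) hT
      refine AgreeOn.mono (setOf_exists_lt_mono e ?_) hm
      rw [one_div_lt_one_div (by positivity) (by positivity)] at hmn
      have : (n : ℝ) < m + 1 := by linarith
      exact Nat.lt_succ_iff.1 (by exact_mod_cast this)
    · simp only [Set.mem_ofPred_eq, shiftSpaceDist, if_true]
      positivity

theorem isOpen_setOf_agreeOn (he : Function.Surjective e) (S : ShiftSpace G A) (n : ℕ) :
    IsOpen[shiftSpaceTopology G A e]
      {T : ShiftSpace G A | AgreeOn {g | ∃ k < n, e k = g} S.1 T.1} :=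
  (isOpen_shiftSpaceTopology_iff he).2 fun _ hT => ⟨n, fun _ hT' => AgreeOn.trans hT hT'⟩

theorem t2Space_shiftSpace (he : Function.Surjective e) :
    @T2Space (ShiftSpace G A) (shiftSpaceTopology G A e) := by
  let := shiftSpaceTopology G A e
  refine ⟨fun S T hne => ?_⟩
  obtain ⟨n, hn⟩ : ∃ n, ¬ AgreeOn {g | ∃ k < n, e k = g} S.1 T.1 := by
    by_contra! h
    exact hne (ShiftSpace.eq_of_forall_agreeOn he h)
  exact ⟨_, _, isOpen_setOf_agreeOn he S n, isOpen_setOf_agreeOn he T n, AgreeOn.rfl, AgreeOn.rfl,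
    Set.disjoint_left.2 fun U hU hU' => hn (AgreeOn.trans hU (AgreeOn.symm hU'))⟩

end ShiftSpace

section Compactness

variable {G A : Type*} {e : ℕ → G} [Group G] [TopologicalSpace A] [DiscreteTopology A]

/-- The configurations every finite part of which occurs in eventually all shifts of a filter. -/
def limitShift (e : ℕ → G) (U : Filter (ShiftSpace G A)) : Set (G → A) :=
  {s | ∀ n, ∀ᶠ T in U, ∃ t ∈ T.1, ∀ a ∈ {g | ∃ k < n, e k = g}, t a = s a}

variable [Finite A]

theorem exists_mem_limitShift_iff (U : Ultrafilter (ShiftSpace G A))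
    (n : ℕ) (p : G → A) :
    (∃ s ∈ limitShift e (U : Filter (ShiftSpace G A)), ∀ a ∈ {g | ∃ k < n, e k = g}, s a = p a) ↔
      ∀ᶠ T in (U : Filter (ShiftSpace G A)),
        ∃ t ∈ T.1, ∀ a ∈ {g | ∃ k < n, e k = g}, t a = p a := by
  constructor
  · rintro ⟨s, hs, hsp⟩
    filter_upwards [hs n] with T ⟨t, ht, hts⟩
    exact ⟨t, ht, fun a ha => (hts a ha).trans (hsp a ha)⟩
  · intro h
    let C : ℕ → Set (G → A) := fun m => {s | (∀ a ∈ {g | ∃ k < n, e k = g}, s a = p a) ∧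
      ∀ᶠ T in (U : Filter (ShiftSpace G A)),
        ∃ t ∈ T.1, ∀ a ∈ {g | ∃ k < m, e k = g}, t a = s a}
    have hclosed : ∀ m, IsClosed (C m) := by
      refine fun m => isClosed_of_closure_subset fun s hs => ?_
      obtain ⟨t, ht, hts⟩ := mem_closure_iff_eq_on_finite.1 hs _
        ((finite_setOf_exists_lt e n).union (finite_setOf_exists_lt e m))
      refine ⟨fun a ha => (hts a (.inl ha)).symm.trans (ht.1 a ha), ?_⟩
      filter_upwards [ht.2] with T ⟨u, hu, hut⟩
      exact ⟨u, hu, fun a ha => (hut a ha).trans (hts a (.inr ha))⟩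
    have hne : ∀ m, (C m).Nonempty := by
      intro m
      obtain ⟨R, hR, hRp⟩ := exists_finite_eq_on (A := A)
        ((finite_setOf_exists_lt e n).union (finite_setOf_exists_lt e m))
      have : ∀ᶠ T in (U : Filter (ShiftSpace G A)), ∃ r ∈ R,
          (∀ a ∈ {g | ∃ k < n, e k = g}, r a = p a) ∧
            ∃ t ∈ T.1, ∀ a ∈ {g | ∃ k < m, e k = g}, t a = r a := by
        filter_upwards [h] with T ⟨t, ht, htp⟩
        obtain ⟨r, hr, hrt⟩ := hRp t
        exact ⟨r, hr, fun a ha => (hrt a (.inl ha)).trans (htp a ha), t, ht,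
          fun a ha => (hrt a (.inr ha)).symm⟩
      obtain ⟨r, hr, hrT⟩ := (Ultrafilter.eventually_exists_mem_iff hR).1 this
      obtain ⟨_, hr'⟩ := hrT.exists
      exact ⟨r, hr'.1, hrT.mono fun _ hT => hT.2⟩
    obtain ⟨s, hs⟩ := IsCompact.nonempty_iInter_of_sequence_nonempty_isCompact_isClosed C
      (fun m s hs => ⟨hs.1, hs.2.mono fun T ⟨t, ht, hts⟩ => ⟨t, ht, fun a ha =>
        hts a (setOf_exists_lt_mono e m.le_succ ha)⟩⟩) hne (hclosed 0).isCompact hclosed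
    rw [Set.mem_iInter] at hs
    exact ⟨s, fun m => (hs m).2, (hs 0).1⟩

theorem isShift_limitShift (he : Function.Surjective e) (U : Ultrafilter (ShiftSpace G A)) :
    IsShift (limitShift e (U : Filter (ShiftSpace G A))) := by
  refine ⟨?_, isClosed_of_closure_subset fun s hs n => ?_, fun s hs g n => ?_⟩
  · obtain ⟨T⟩ := U.neBot.nonempty
    obtain ⟨t, -⟩ := T.2.1
    obtain ⟨s, hs, -⟩ := (exists_mem_limitShift_iff U 0 t).2
      (.of_forall fun T => ⟨T.2.1.some, T.2.1.some_mem, by simp⟩)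
    exact ⟨s, hs⟩
  · obtain ⟨t, ht, hts⟩ := mem_closure_iff_eq_on_finite.1 hs _ (finite_setOf_exists_lt e n)
    filter_upwards [ht n] with T ⟨u, hu, hut⟩
    exact ⟨u, hu, fun a ha => (hut a ha).trans (hts a ha)⟩
  · obtain ⟨m, hm⟩ := he.exists_subset_setOf_lt
      ((finite_setOf_exists_lt e n).image fun a => g⁻¹ * a)
    filter_upwards [hs m] with T ⟨t, ht, hts⟩
    exact ⟨shiftAct g t, T.2.2.2 t ht g, fun a ha => hts _ (hm ⟨a, ha, rfl⟩)⟩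

theorem eventually_agreeOn_limitShift
    (U : Ultrafilter (ShiftSpace G A)) (n : ℕ) :
    ∀ᶠ T in (U : Filter (ShiftSpace G A)),
      AgreeOn {g | ∃ k < n, e k = g} (limitShift e (U : Filter (ShiftSpace G A))) T.1 := by
  obtain ⟨R, hR, hRp⟩ := exists_finite_eq_on (A := A) (finite_setOf_exists_lt e n)
  have : ∀ᶠ T in (U : Filter (ShiftSpace G A)), ∀ r ∈ R,
      ((∃ s ∈ limitShift e (U : Filter (ShiftSpace G A)),
        ∀ a ∈ {g | ∃ k < n, e k = g}, s a = r a) ↔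
        ∃ t ∈ T.1, ∀ a ∈ {g | ∃ k < n, e k = g}, t a = r a) := by
    refine (eventually_all_finite hR).2 fun r _ => ?_
    by_cases h : ∃ s ∈ limitShift e (U : Filter (ShiftSpace G A)),
        ∀ a ∈ {g | ∃ k < n, e k = g}, s a = r a
    · filter_upwards [(exists_mem_limitShift_iff U n r).1 h] with T hT
      exact iff_of_true h hT
    · filter_upwards [Ultrafilter.eventually_not.2
        (mt (exists_mem_limitShift_iff U n r).2 h)] with T hT
      exact iff_of_false h hT
  filter_upwards [this] with T hT p
  obtain ⟨r, hr, hrp⟩ := hRp p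
  have key : ∀ S : Set (G → A), (∃ s ∈ S, ∀ a ∈ {g | ∃ k < n, e k = g}, s a = p a) ↔
      ∃ s ∈ S, ∀ a ∈ {g | ∃ k < n, e k = g}, s a = r a := fun S =>
    exists_congr fun s => and_congr_right fun _ => forall₂_congr fun a ha => by rw [hrp a ha]
  rw [key, key]
  exact hT r hr

theorem compactSpace_shiftSpace (he : Function.Surjective e) :
    @CompactSpace (ShiftSpace G A) (shiftSpaceTopology G A e) := by
  let := shiftSpaceTopology G A e
  refine ⟨isCompact_iff_ultrafilter_le_nhds.2 fun U _ =>
    ⟨⟨_, isShift_limitShift he U⟩, Set.mem_univ _, fun V hV => ?_⟩⟩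
  obtain ⟨V', hV', hopen, hmem⟩ := mem_nhds_iff.1 hV
  obtain ⟨n, hn⟩ := (isOpen_shiftSpaceTopology_iff he).1 hopen _ hmem
  exact mem_of_superset (eventually_agreeOn_limitShift U n) (hn.trans hV')

theorem isClosed_setOf_constant (he : Function.Surjective e) :
    IsClosed[shiftSpaceTopology G A e] {S : ShiftSpace G A | ∃ a : A, S.1 = {fun _ => a}} := by
  let := shiftSpaceTopology G A e
  have := t2Space_shiftSpace (A := A) he
  refine Set.Finite.isClosed ?_
  refine Set.Finite.of_finite_image (f := Subtype.val) ?_ Subtype.val_injective.injOn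
  refine (Set.finite_range fun a : A => ({fun _ => a} : Set (G → A))).subset ?_
  rintro _ ⟨S, ⟨a, ha⟩, rfl⟩
  exact ⟨a, ha.symm⟩

theorem baireSpace_scriptS (he : Function.Surjective e) :
    @BaireSpace (scriptS G A e) (scriptSTopology G A e) := by
  let := shiftSpaceTopology G A e
  have := t2Space_shiftSpace (A := A) he
  have := compactSpace_shiftSpace (A := A) he
  have : LocallyCompactSpace (scriptS G A e) :=
    (isClosed_closure.isLocallyClosed.inter
      (isClosed_setOf_constant he).isOpen_compl.isLocallyClosed).locallyCompactSpace
  exact (inferInstance : BaireSpace (scriptS G A e))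

end Compactness

section Generic

variable {G A : Type*} [Group G]

/-- Some element of a fixed finite set moves any two configurations of `S` simultaneously onto any
given pattern on `F` occurring in `S`. -/
def UniformlyContracts (F : Set G) (S : Set (G → A)) : Prop :=
  ∃ K : Set G, K.Finite ∧ ∀ s ∈ S, ∀ t ∈ S, ∀ u ∈ S,
    ∃ g ∈ K, ∀ a ∈ F, shiftAct g s a = u a ∧ shiftAct g t a = u a

theorem UniformlyContracts.mono {F F' : Set G} {S : Set (G → A)} (hF : F ⊆ F')
    (h : UniformlyContracts F' S) : UniformlyContracts F S := by
  obtain ⟨K, hK, h⟩ := h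
  refine ⟨K, hK, fun s hs t ht u hu => ?_⟩
  obtain ⟨g, hg, hgF⟩ := h s hs t ht u hu
  exact ⟨g, hg, fun a ha => hgF a (hF ha)⟩

theorem stronglyIrreducible_univ : StronglyIrreducible (Set.univ : Set (G → A)) := by
  classical
  refine ⟨{1}, by simp, fun E₁ E₂ hE s₁ _ s₂ _ => ⟨E₁.piecewise s₁ s₂, Set.mem_univ _,
    fun a ha => Set.piecewise_eq_of_mem _ _ _ ha, fun a ha => Set.piecewise_eq_of_notMem _ _ _ ?_⟩⟩
  intro ha'
  have : a ∈ (∅ : Set G) := hE ▸ by simp [ha, ha']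
  exact this

theorem isShift_univ [TopologicalSpace A] [Nonempty A] : IsShift (Set.univ : Set (G → A)) :=
  ⟨Set.univ_nonempty, isClosed_univ, fun _ _ _ => Set.mem_univ _⟩

theorem nonempty_scriptS [TopologicalSpace A] [Nontrivial A] {e : ℕ → G} :
    (scriptS G A e).Nonempty := by
  refine ⟨⟨Set.univ, isShift_univ⟩, @subset_closure _ (shiftSpaceTopology G A e) _ _
    stronglyIrreducible_univ, ?_⟩
  rintro ⟨a, ha : Set.univ = {fun _ => a}⟩
  obtain ⟨b, hb⟩ := exists_ne a
  have : (fun _ => b : G → A) ∈ ({fun _ => a} : Set (G → A)) := ha ▸ Set.mem_univ _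
  exact hb (congrFun this 1)

variable [TopologicalSpace A] [DiscreteTopology A]

theorem minimalShift_of_uniformlyContracts {S : Set (G → A)}
    (h : ∀ F : Set G, F.Finite → UniformlyContracts F S) : MinimalShift S := by
  refine fun s hs u hu => mem_closure_iff_eq_on_finite.2 fun F hF => ?_
  obtain ⟨K, -, hK⟩ := h F hF
  obtain ⟨g, -, hg⟩ := hK s hs s hs u hu
  exact ⟨_, ⟨g, rfl⟩, fun a ha => (hg a ha).1⟩

theorem proximalShift_of_uniformlyContracts {S : Set (G → A)}
    (h : ∀ F : Set G, F.Finite → UniformlyContracts F S) : ProximalShift S := by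
  refine fun s hs t ht => ⟨s, hs, ?_⟩
  rw [mem_closure_iff_nhds_basis ((nhds_basis_eq_on_finite s).prod_nhds
    (nhds_basis_eq_on_finite s))]
  rintro ⟨F, F'⟩ ⟨hF, hF'⟩
  obtain ⟨K, -, hK⟩ := h (F ∪ F') (hF.union hF')
  obtain ⟨g, -, hg⟩ := hK s hs t ht s hs
  exact ⟨_, ⟨g, rfl⟩, fun a ha => (hg a (.inl ha)).1, fun a ha => (hg a (.inr ha)).2⟩

variable {e : ℕ → G}

theorem isOpen_setOf_uniformlyContracts (he : Function.Surjective e) {F : Set G}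
    (hF : F.Finite) : IsOpen[shiftSpaceTopology G A e]
      {S : ShiftSpace G A | UniformlyContracts F S.1} := by
  refine (isOpen_shiftSpaceTopology_iff he).2 fun S ⟨K, hK, hS⟩ => ?_
  obtain ⟨n, hn⟩ := he.exists_subset_setOf_lt (hF.union (hK.inv.mul hF))
  refine ⟨n, fun T hT => ⟨K, hK, fun s hs t ht u hu => ?_⟩⟩
  have hTS := AgreeOn.mono hn (AgreeOn.symm hT)
  obtain ⟨s', hs', hss'⟩ := hTS.exists_eq_on hs
  obtain ⟨t', ht', htt'⟩ := hTS.exists_eq_on ht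
  obtain ⟨u', hu', huu'⟩ := hTS.exists_eq_on hu
  obtain ⟨g, hg, hgF⟩ := hS s' hs' t' ht' u' hu'
  refine ⟨g, hg, fun a ha => ?_⟩
  have hga : g⁻¹ * a ∈ F ∪ K⁻¹ * F := .inr (Set.mul_mem_mul (Set.inv_mem_inv.2 hg) ha)
  rw [← huu' a (.inl ha), shiftAct, shiftAct, ← hss' _ hga, ← htt' _ hga]
  exact hgF a ha

theorem dense_setOf_uniformlyContracts [Finite A] (hG : IsICC G) (he : Function.Surjective e)
    {F : Set G} (hF : F.Finite) :
    @Dense (scriptS G A e) (scriptSTopology G A e)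
      {S : scriptS G A e | UniformlyContracts F S.1.1} := by
  let := shiftSpaceTopology G A e
  change Dense {S : scriptS G A e | UniformlyContracts F S.1.1}
  refine dense_iff_inter_open.2 ?_
  rintro _ ⟨O, hO, rfl⟩ ⟨⟨S, hSc, hSn⟩, hSO : S ∈ O⟩
  have hO' := hO.inter (isClosed_setOf_constant (A := A) he).isOpen_compl
  obtain ⟨T, ⟨hTO, hT⟩⟩ := mem_closure_iff.1 hSc _ hO' ⟨hSO, hSn⟩
  obtain ⟨n, hn⟩ := (isOpen_shiftSpaceTopology_iff he).1 hO' T hTO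
  obtain ⟨T', hT', hT'I, hTT', hT'F⟩ := StronglyIrreducible.exists_subshift hG T.2 hT
    ((finite_setOf_exists_lt e n).union hF)
  have hmem := @hn ⟨T', hT'⟩ (hTT'.mono Set.subset_union_left)
  exact ⟨⟨⟨T', hT'⟩, subset_closure hT'I, hmem.2⟩, hmem.1,
    UniformlyContracts.mono Set.subset_union_right hT'F⟩

end Generic

end

/-- For a countable ICC group `G` and a finite alphabet `A` with `|A| ≥ 2`, the set of shifts
in `𝒮` on which the `G`-action is both minimal and proximal contains a dense `G_δ` subset of
`𝒮`; in particular it is nonempty. -/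
theorem minimal_proximal_contains_dense_Gδ
    (G : Type) [Group G] [Countable G] (hICC : IsICC G)
    (A : Type) [Fintype A] [TopologicalSpace A] [DiscreteTopology A]
    (hA : 2 ≤ Fintype.card A)
    (e : ℕ → G) (he : Function.Surjective e) :
    (∃ R : Set ↥(scriptS G A e),
      @Dense ↥(scriptS G A e) (scriptSTopology G A e) R ∧
      @IsGδ ↥(scriptS G A e) (scriptSTopology G A e) R ∧
      R ⊆ {S : ↥(scriptS G A e) | MinimalShift S.1.1 ∧ ProximalShift S.1.1}) ∧
    {S : ↥(scriptS G A e) | MinimalShift S.1.1 ∧ ProximalShift S.1.1}.Nonempty := by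
  have : Nontrivial A := Fintype.one_lt_card_iff_nontrivial.1 hA
  have : Nonempty (scriptS G A e) := nonempty_scriptS.to_subtype
  let := shiftSpaceTopology G A e
  let := scriptSTopology G A e
  have := baireSpace_scriptS (A := A) he
  let W : ℕ → Set (scriptS G A e) := fun n =>
    {S | UniformlyContracts {g | ∃ k < n, e k = g} S.1.1}
  have hopen : ∀ n, IsOpen (W n) := fun n =>
    (isOpen_setOf_uniformlyContracts he (finite_setOf_exists_lt e n)).preimage
      continuous_induced_dom
  have hdense : Dense (⋂ n, W n) := dense_iInter_of_isOpen hopen fun n =>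
    dense_setOf_uniformlyContracts hICC he (finite_setOf_exists_lt e n)
  have hsub : ⋂ n, W n ⊆
      {S : scriptS G A e | MinimalShift S.1.1 ∧ ProximalShift S.1.1} := by
    intro S hS
    have h : ∀ F : Set G, F.Finite → UniformlyContracts F S.1.1 := fun F hF => by
      obtain ⟨n, hn⟩ := he.exists_subset_setOf_lt hF
      exact UniformlyContracts.mono hn (Set.mem_iInter.1 hS n)
    exact ⟨minimalShift_of_uniformlyContracts h, proximalShift_of_uniformlyContracts h⟩
  exact ⟨⟨_, hdense, .iInter_of_isOpen hopen, hsub⟩, hdense.nonempty.mono hsub⟩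
end

section
/- Let G be a countable group, let g ∈ G be a non-identity element with a finite conjugacy class, and let X ⊆ G be a finite symmetric subset containing every conjugate of g. Then there is no X-witness configuration in 2^G: no u ∈ 2^G satisfies both (1) for every s in the orbit G·u, s(a) = s(b) = 1 implies a and b are X-apart, and (2) for every s, t in the orbit G·u there exists a ∈ G with s(a) = t(a) = 1. -/
/-- The orbit `G • u` of a configuration `u ∈ 2^G`. -/
def confOrbit {G A : Type*} [Group G] (u : G → A) : Set (G → A) :=
  {s | ∃ g : G, s = shiftAct g u}

/-- For a finite symmetric `X ⊆ G`, elements `a, b ∈ G` are `X`-apart if `a⁻¹ * b ∉ X`. -/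
def XApart {G : Type*} [Group G] (X : Finset G) (a b : G) : Prop :=
  a⁻¹ * b ∉ X

/-- A configuration `u ∈ 2^G` is an `X`-witness configuration if (1) for every `s` in the
orbit `G • u`, distinct `a, b` with `s a = s b = 1` are `X`-apart, and (2) for all `s, t` in
the orbit `G • u` there is `a ∈ G` with `s a = t a = 1`. -/
def IsWitnessConfiguration {G : Type*} [Group G] (X : Finset G) (u : G → Fin 2) : Prop :=
  (∀ s ∈ confOrbit u, ∀ a b : G, s a = 1 → s b = 1 → a ≠ b → XApart X a b) ∧
  (∀ s ∈ confOrbit u, ∀ t ∈ confOrbit u, ∃ a : G, s a = 1 ∧ t a = 1)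

/-- Let `G` be a countable group, `g ∈ G` a non-identity element with a finite conjugacy
class, and `X ⊆ G` a finite symmetric subset containing every conjugate of `g`.  Then there
is no `X`-witness configuration in `2^G`. -/
theorem no_witness_configuration_of_finite_conjugacy_class
    (G : Type) [Group G] [Countable G]
    (g : G) (hg : g ≠ 1) (hgfin : {h : G | IsConj g h}.Finite)
    (X : Finset G) (hXsym : ∀ x ∈ X, x⁻¹ ∈ X)
    (hXconj : ∀ h : G, IsConj g h → h ∈ X) :
    ¬ ∃ u : G → Fin 2, IsWitnessConfiguration X u := by
  rintro ⟨u, hapart, hmeet⟩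
  have hu : u ∈ confOrbit u := ⟨1, by funext h; simp [shiftAct]⟩
  obtain ⟨a, ha, hga⟩ := hmeet u hu (shiftAct g u) ⟨g, rfl⟩
  refine hapart u hu (g⁻¹ * a) a hga ha (by simpa using hg) (hXconj _ ?_)
  exact isConj_iff.mpr ⟨a⁻¹, by group⟩
end
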